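/- arXiv:2011.09441 — 2 statements merged into one kernel-verified Lean document; each statement's English description precedes it below -/
import Mathlib

section
/- There exists a universal constant C > 0 such that for every dimension d ≥ 1, every function f : {0,1}^d → ℝ, and every 2-coloring col : S_f^- → {red, blue} of the violated edges, (1/2^d) · Σ_{x ∈ {0,1}^d} sqrt(I_{f,red}^-(x)) + (1/2^d) · Σ_{y ∈ {0,1}^d} sqrt(I_{f,blue}^-(y)) ≥ C · ε(f). -/
/-- A directed hypercube edge: `y` is obtained from `x` by flipping one coordinate
from `false` to `true`. -/
def IsEdge {d : ℕ} (x y : Fin d → Bool) : Prop :=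
  ∃ i : Fin d, x i = false ∧ y i = true ∧ ∀ j : Fin d, j ≠ i → x j = y j

/-- A function on the hypercube is monotone if it respects the coordinatewise order. -/
def MonotoneCube {d : ℕ} (g : (Fin d → Bool) → ℝ) : Prop :=
  ∀ x y : Fin d → Bool, (∀ i, x i ≤ y i) → g x ≤ g y

/-- Distance to monotonicity. -/
noncomputable def distMono (d : ℕ) (f : (Fin d → Bool) → ℝ) : ℝ :=
  ((sInf {n : ℕ | ∃ g : (Fin d → Bool) → ℝ, MonotoneCube g ∧
      n = Nat.card {x : Fin d → Bool // f x ≠ g x}} : ℕ) : ℝ) / 2 ^ d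

/-- `I_{f,red}^-(x)`: the number of outgoing red violated edges at `x`.
The coloring `col` maps a pair of endpoints to `true` (red) or `false` (blue). -/
noncomputable def redOut (d : ℕ) (f : (Fin d → Bool) → ℝ)
    (col : (Fin d → Bool) × (Fin d → Bool) → Bool) (x : Fin d → Bool) : ℕ :=
  Nat.card {y : Fin d → Bool // IsEdge x y ∧ f x > f y ∧ col (x, y) = true}

/-- `I_{f,blue}^-(y)`: the number of incoming blue violated edges at `y`. -/
noncomputable def blueIn (d : ℕ) (f : (Fin d → Bool) → ℝ)
    (col : (Fin d → Bool) × (Fin d → Bool) → Bool) (y : Fin d → Bool) : ℕ :=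
  Nat.card {x : Fin d → Bool // IsEdge x y ∧ f x > f y ∧ col (x, y) = false}

open Finset

/-- The point obtained from `x` by flipping coordinate `i`. -/
def flipAt {n : ℕ} (i : Fin n) (x : Fin n → Bool) : Fin n → Bool :=
  Function.update x i (!x i)

/-- The sign `(-1) ^ b`. -/
def boolSign (b : Bool) : ℝ := if b then -1 else 1

/-- The density at `N` of the product measure on the cube whose coordinate signs have mean `c`. -/
noncomputable def noiseWeight {n : ℕ} (c : ℝ) (N : Fin n → Bool) : ℝ :=
  ∏ i, (1 + boolSign (N i) * c) / 2

lemma flipAt_flipAt {n : ℕ} (i : Fin n) (x : Fin n → Bool) : flipAt i (flipAt i x) = x := by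
  simp [flipAt]

lemma flipAt_apply_self {n : ℕ} (i : Fin n) (x : Fin n → Bool) : flipAt i x i = !x i := by
  simp [flipAt]

lemma flipAt_apply_of_ne {n : ℕ} {i j : Fin n} (h : j ≠ i) (x : Fin n → Bool) :
    flipAt i x j = x j := by
  simp [flipAt, h]

lemma sum_flipAt {n : ℕ} (i : Fin n) (φ : (Fin n → Bool) → ℝ) :
    ∑ x, φ (flipAt i x) = ∑ x, φ x :=
  Equiv.sum_comp (Function.Involutive.toPerm (flipAt i) (flipAt_flipAt i)) φ

lemma sum_prod_bool {n : ℕ} (φ : Fin n → Bool → ℝ) :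
    ∑ N : Fin n → Bool, ∏ i, φ i (N i) = ∏ i, (φ i true + φ i false) := by
  have h := (Finset.prod_univ_sum (fun _ : Fin n => (univ : Finset Bool)) φ).symm
  rw [Fintype.piFinset_univ] at h
  simpa using h

lemma boolSign_mul_self (b : Bool) : boolSign b * boolSign b = 1 := by
  cases b <;> simp [boolSign]

lemma boolSign_not (b : Bool) : boolSign (!b) = -boolSign b := by
  cases b <;> simp [boolSign]

lemma one_add_boolSign_mul_pos {c : ℝ} (hc : c ^ 2 < 1) (b : Bool) : 0 < 1 + boolSign b * c := by
  have := abs_lt.1 ((sq_lt_one_iff_abs_lt_one c).1 hc)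
  cases b <;> simp [boolSign] <;> linarith

lemma noiseWeight_pos {n : ℕ} {c : ℝ} (hc : c ^ 2 < 1) (N : Fin n → Bool) :
    0 < noiseWeight c N :=
  Finset.prod_pos fun _ _ => div_pos (one_add_boolSign_mul_pos hc _) two_pos

lemma sum_noiseWeight {n : ℕ} (c : ℝ) : ∑ N : Fin n → Bool, noiseWeight c N = 1 := by
  unfold noiseWeight
  rw [sum_prod_bool (fun _ b => (1 + boolSign b * c) / 2)]
  refine Finset.prod_eq_one fun i _ => ?_
  simp [boolSign]; ring

/-- The normalised coordinate functions are orthogonal for the noise measure. -/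
lemma sum_noiseWeight_mul_score {n : ℕ} {c : ℝ} (hc : c ^ 2 < 1) (i j : Fin n) :
    ∑ N : Fin n → Bool, noiseWeight c N * ((boolSign (N i) / (1 + boolSign (N i) * c)) *
      (boolSign (N j) / (1 + boolSign (N j) * c))) = if i = j then 1 / (1 - c ^ 2) else 0 := by
  have h1 := (one_add_boolSign_mul_pos hc true).ne'
  have h0 := (one_add_boolSign_mul_pos hc false).ne'
  simp only [boolSign, if_true, Bool.false_eq_true, if_false, neg_one_mul, one_mul,
    ← sub_eq_add_neg] at h1 h0
  have key : ∀ N : Fin n → Bool, noiseWeight c N * ((boolSign (N i) / (1 + boolSign (N i) * c)) *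
      (boolSign (N j) / (1 + boolSign (N j) * c))) =
      ∏ k, ((1 + boolSign (N k) * c) / 2 *
        ((if k = i then boolSign (N k) / (1 + boolSign (N k) * c) else 1) *
         (if k = j then boolSign (N k) / (1 + boolSign (N k) * c) else 1))) := by
    intro N
    rw [Finset.prod_mul_distrib, Finset.prod_mul_distrib, Finset.prod_ite_eq', Finset.prod_ite_eq']
    simp [noiseWeight]
  simp_rw [key]
  rw [sum_prod_bool (fun k b => (1 + boolSign b * c) / 2 *
        ((if k = i then boolSign b / (1 + boolSign b * c) else 1) *
         (if k = j then boolSign b / (1 + boolSign b * c) else 1)))]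
  have h2 : 1 - c ^ 2 ≠ 0 := by linarith
  split_ifs with hij
  · subst hij
    rw [Finset.prod_eq_single i]
    · simp only [boolSign, if_true, Bool.false_eq_true, if_false, neg_one_mul, one_mul,
        ← sub_eq_add_neg]
      field_simp
      ring
    · intro k _ hk
      simp [hk, boolSign]; ring
    · simp
  · refine Finset.prod_eq_zero (mem_univ i) ?_
    simp only [boolSign, if_true, Bool.false_eq_true, if_false, if_neg hij, neg_one_mul, one_mul,
      ← sub_eq_add_neg]
    field_simp
    ring

/-- Bessel's inequality for an orthogonal family in a finite probability space. -/
lemma bessel_of_orthogonal {Ω ι : Type*} [Fintype Ω] [Fintype ι] [DecidableEq ι]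
    (W : Ω → ℝ) (hW : ∀ ω, 0 ≤ W ω) (hW1 : ∑ ω, W ω = 1) (χ : ι → Ω → ℝ) {v : ℝ} (hv : 0 < v)
    (hχ : ∀ i j, ∑ ω, W ω * (χ i ω * χ j ω) = if i = j then v else 0)
    (f : Ω → ℝ) (hf : ∀ ω, f ω * f ω = 1) :
    ∑ i, (∑ ω, W ω * (χ i ω * f ω)) ^ 2 ≤ v := by
  set q : ι → ℝ := fun i => ∑ ω, W ω * (χ i ω * f ω) with hq
  have h0 : 0 ≤ ∑ ω, W ω * (v * f ω - ∑ i, q i * χ i ω) ^ 2 :=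
    Finset.sum_nonneg fun ω _ => mul_nonneg (hW ω) (sq_nonneg _)
  have e1 : ∑ ω, W ω * (f ω * ∑ i, q i * χ i ω) = ∑ i, q i ^ 2 := by
    simp_rw [Finset.mul_sum]
    rw [Finset.sum_comm]
    refine Finset.sum_congr rfl fun i _ => ?_
    rw [sq, hq, Finset.mul_sum]
    exact Finset.sum_congr rfl fun ω _ => by ring
  have e2 : ∑ ω, W ω * (∑ i, q i * χ i ω) ^ 2 = v * ∑ i, q i ^ 2 := by
    have : ∀ ω, W ω * (∑ i, q i * χ i ω) ^ 2
        = ∑ i, ∑ j, q i * q j * (W ω * (χ i ω * χ j ω)) := by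
      intro ω
      rw [sq, Finset.sum_mul_sum, Finset.mul_sum]
      refine Finset.sum_congr rfl fun i _ => ?_
      rw [Finset.mul_sum]
      exact Finset.sum_congr rfl fun j _ => by ring
    simp_rw [this]
    rw [Finset.sum_comm, Finset.mul_sum]
    refine Finset.sum_congr rfl fun i _ => ?_
    rw [Finset.sum_comm]
    simp_rw [← Finset.mul_sum, hχ]
    simp
    ring
  have e3 : ∑ ω, W ω * (v * f ω - ∑ i, q i * χ i ω) ^ 2
      = v ^ 2 * ∑ ω, W ω - 2 * v * ∑ ω, W ω * (f ω * ∑ i, q i * χ i ω)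
        + ∑ ω, W ω * (∑ i, q i * χ i ω) ^ 2 := by
    rw [Finset.mul_sum, Finset.mul_sum, ← Finset.sum_sub_distrib, ← Finset.sum_add_distrib]
    refine Finset.sum_congr rfl fun ω _ => ?_
    linear_combination (W ω * v ^ 2) * hf ω
  rw [e3, e1, e2, hW1] at h0
  nlinarith

lemma hasDerivAt_noiseWeight_cos {n : ℕ} (N : Fin n → Bool) (θ : ℝ) :
    HasDerivAt (fun t => noiseWeight (Real.cos t) N)
      (-Real.sin θ * ∑ i, (∏ j ∈ univ.erase i, (1 + boolSign (N j) * Real.cos θ) / 2) *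
        (boolSign (N i) / 2)) θ := by
  have h := HasDerivAt.fun_finsetProd (u := (univ : Finset (Fin n)))
    (f := fun i t => (1 + boolSign (N i) * Real.cos t) / 2)
    (f' := fun i => (boolSign (N i) * (-Real.sin θ)) / 2) (x := θ)
    (fun i _ => (((Real.hasDerivAt_cos θ).const_mul _).const_add 1).div_const 2)
  refine h.congr_deriv ?_
  rw [Finset.mul_sum]
  refine Finset.sum_congr rfl fun i _ => ?_
  simp only [smul_eq_mul]
  ring

lemma prod_erase_eq_noiseWeight_div {n : ℕ} {c : ℝ} (hc : c ^ 2 < 1) (N : Fin n → Bool)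
    (i : Fin n) :
    (∏ j ∈ univ.erase i, (1 + boolSign (N j) * c) / 2) * (boolSign (N i) / 2)
      = noiseWeight c N * (boolSign (N i) / (1 + boolSign (N i) * c)) := by
  have h := (one_add_boolSign_mul_pos hc (N i)).ne'
  unfold noiseWeight
  rw [← Finset.mul_prod_erase univ _ (mem_univ i)]
  generalize ∏ j ∈ univ.erase i, (1 + boolSign (N j) * c) / 2 = P
  field_simp

lemma noiseWeight_one {n : ℕ} (N : Fin n → Bool) :
    noiseWeight 1 N = if N = fun _ => false then 1 else 0 := by
  split_ifs with h
  · subst h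
    simp [noiseWeight, boolSign]
  · obtain ⟨i, hi⟩ := Function.ne_iff.1 h
    refine Finset.prod_eq_zero (mem_univ i) ?_
    simp at hi
    simp [hi, boolSign]

lemma noiseWeight_neg_one {n : ℕ} (N : Fin n → Bool) :
    noiseWeight (-1) N = if N = fun _ => true then 1 else 0 := by
  split_ifs with h
  · subst h
    simp [noiseWeight, boolSign]
  · obtain ⟨i, hi⟩ := Function.ne_iff.1 h
    refine Finset.prod_eq_zero (mem_univ i) ?_
    simp at hi
    simp [hi, boolSign]

/-- The derivative of the noise stability of a two-valued function is controlled by any choice,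
for each sensitive edge, of an endpoint to which the edge is charged. -/
lemma abs_sum_edge_score_le {n : ℕ} (G : (Fin n → Bool) → Bool)
    (J : (Fin n → Bool) → Finset (Fin n))
    (hJ : ∀ D i, G D ≠ G (flipAt i D) → i ∈ J D ∨ i ∈ J (flipAt i D)) {c : ℝ} (hc : c ^ 2 < 1) :
    |∑ i, ∑ D, boolSign (G D) * ∑ N, noiseWeight c N *
        ((boolSign (N i) / (1 + boolSign (N i) * c)) * boolSign (G fun k => xor (D k) (N k)))|
      ≤ 2 * Real.sqrt (1 / (1 - c ^ 2)) * ∑ D, Real.sqrt (#(J D)) := by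
  set q : Fin n → (Fin n → Bool) → ℝ := fun i D => ∑ N, noiseWeight c N *
    ((boolSign (N i) / (1 + boolSign (N i) * c)) * boolSign (G fun k => xor (D k) (N k))) with hq
  have hflip : ∀ i D, q i (flipAt i D) = -q i D := by
    intro i D
    simp only [hq]
    rw [← sum_flipAt i, ← Finset.sum_neg_distrib]
    refine Finset.sum_congr rfl fun N _ => ?_
    rw [← mul_assoc, ← mul_assoc, ← prod_erase_eq_noiseWeight_div hc,
      ← prod_erase_eq_noiseWeight_div hc]
    have e1 : (fun k => xor (flipAt i D k) (flipAt i N k)) = fun k => xor (D k) (N k) := by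
      funext k
      by_cases hk : k = i
      · subst hk; simp [flipAt_apply_self]
      · simp [flipAt_apply_of_ne hk]
    have e2 : ∏ j ∈ univ.erase i, (1 + boolSign (flipAt i N j) * c) / 2
        = ∏ j ∈ univ.erase i, (1 + boolSign (N j) * c) / 2 :=
      Finset.prod_congr rfl fun j hj => by rw [flipAt_apply_of_ne (Finset.ne_of_mem_erase hj)]
    rw [e1, e2, flipAt_apply_self, boolSign_not]
    ring
  have hdir : ∀ i, |∑ D, boolSign (G D) * q i D| ≤ 2 * ∑ D, if i ∈ J D then |q i D| else 0 := by
    intro i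
    have h1 : ∑ D, boolSign (G D) * q i D
        = (∑ D, (boolSign (G D) - boolSign (G (flipAt i D))) * q i D) / 2 := by
      have := sum_flipAt i (fun D => boolSign (G D) * q i D)
      simp only [hflip] at this
      simp only [sub_mul, Finset.sum_sub_distrib]
      simp only [mul_neg, Finset.sum_neg_distrib] at this
      linarith
    have h2 : ∀ D, |(boolSign (G D) - boolSign (G (flipAt i D))) * q i D|
        ≤ 2 * ((if i ∈ J D then |q i D| else 0) +
          (if i ∈ J (flipAt i D) then |q i (flipAt i D)| else 0)) := by
      intro D
      rw [hflip, abs_neg, abs_mul]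
      have hqn := abs_nonneg (q i D)
      by_cases hG : G D = G (flipAt i D)
      · rw [hG]; simp; positivity
      · have hb : |boolSign (G D) - boolSign (G (flipAt i D))| ≤ 2 := by
          cases G D <;> cases G (flipAt i D) <;> norm_num [boolSign]
        have : |q i D| ≤ (if i ∈ J D then |q i D| else 0) +
          (if i ∈ J (flipAt i D) then |q i D| else 0) := by
          rcases hJ D i hG with h | h
          · rw [if_pos h]; split_ifs <;> linarith
          · rw [if_pos h]; split_ifs <;> linarith
        exact mul_le_mul hb this hqn two_pos.le
    have h3 := (Finset.abs_sum_le_sum_abs (fun D => (boolSign (G D) -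
      boolSign (G (flipAt i D))) * q i D) univ).trans (Finset.sum_le_sum fun D _ => h2 D)
    rw [← Finset.mul_sum, Finset.sum_add_distrib,
      sum_flipAt i (fun D => if i ∈ J D then |q i D| else 0)] at h3
    rw [h1, abs_div, abs_two]
    linarith
  calc |∑ i, ∑ D, boolSign (G D) * q i D| ≤ ∑ i, |∑ D, boolSign (G D) * q i D| :=
        Finset.abs_sum_le_sum_abs _ _
    _ ≤ ∑ i, 2 * ∑ D, (if i ∈ J D then |q i D| else 0) := Finset.sum_le_sum fun i _ => hdir i
    _ = 2 * ∑ D, ∑ i ∈ J D, |q i D| := by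
        rw [← Finset.mul_sum, Finset.sum_comm]
        simp
    _ ≤ 2 * ∑ D, Real.sqrt (1 / (1 - c ^ 2)) * Real.sqrt (#(J D)) := by
        gcongr with D
        have hb := bessel_of_orthogonal (noiseWeight c) (fun N => (noiseWeight_pos hc N).le)
          (sum_noiseWeight (n := n) c) (fun i N => boolSign (N i) / (1 + boolSign (N i) * c))
          (v := 1 / (1 - c ^ 2)) (by apply one_div_pos.2; linarith) (sum_noiseWeight_mul_score hc)
          (fun N => boolSign (G fun k => xor (D k) (N k))) (fun N => boolSign_mul_self _)
        have hsub : ∑ i ∈ J D, |q i D| ^ 2 ≤ 1 / (1 - c ^ 2) := by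
          simp only [sq_abs]
          exact (Finset.sum_le_univ_sum_of_nonneg fun i => sq_nonneg _).trans hb
        rw [← Real.sqrt_mul (by apply (one_div_pos.2 _).le; linarith)]
        apply Real.le_sqrt_of_sq_le
        calc (∑ i ∈ J D, |q i D|) ^ 2 ≤ #(J D) * ∑ i ∈ J D, |q i D| ^ 2 :=
              sq_sum_le_card_mul_sum_sq
          _ ≤ #(J D) * (1 / (1 - c ^ 2)) := by gcongr
          _ = _ := by ring
    _ = _ := by rw [← Finset.mul_sum]; ring

/-- A robust Talagrand-type inequality on the undirected hypercube: if each sensitive edge of `G`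
is charged to one of its endpoints, then the number of points at which `G` differs from its
antipodal value is at most `π` times the sum of the square roots of the charges. -/
theorem card_ne_antipodal_le {n : ℕ} (G : (Fin n → Bool) → Bool)
    (J : (Fin n → Bool) → Finset (Fin n))
    (hJ : ∀ D i, G D ≠ G (flipAt i D) → i ∈ J D ∨ i ∈ J (flipAt i D)) :
    (#{D | G D ≠ G fun i => !D i} : ℝ) ≤ Real.pi * ∑ D, Real.sqrt (#(J D)) := by
  set ψ : ℝ → ℝ := fun t => ∑ D : Fin n → Bool, ∑ N : Fin n → Bool, noiseWeight (Real.cos t) N *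
    (boolSign (G D) * boolSign (G fun k => xor (D k) (N k))) with hψ
  set ψ' : ℝ → ℝ := fun t => ∑ D : Fin n → Bool, ∑ N : Fin n → Bool,
    (-Real.sin t * ∑ i, (∏ j ∈ univ.erase i,
    (1 + boolSign (N j) * Real.cos t) / 2) * (boolSign (N i) / 2)) *
    (boolSign (G D) * boolSign (G fun k => xor (D k) (N k))) with hψ'
  set M := ∑ D, Real.sqrt (#(J D)) with hM
  have hM0 : 0 ≤ M := Finset.sum_nonneg fun D _ => Real.sqrt_nonneg _
  have hder : ∀ t, HasDerivAt ψ (ψ' t) t := fun t =>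
    HasDerivAt.fun_sum fun D _ => HasDerivAt.fun_sum fun N _ =>
      (hasDerivAt_noiseWeight_cos N t).mul_const _
  have hbound : ∀ t, ‖ψ' t‖ ≤ 2 * M := by
    intro t
    by_cases hs : Real.sin t = 0
    · simp [hψ', hs, hM0]
    have hc : Real.cos t ^ 2 < 1 := by
      have := Real.sin_sq_add_cos_sq t
      have := pow_pos (abs_pos.2 hs) 2
      rw [sq_abs] at this
      linarith
    have e : ψ' t = -Real.sin t * ∑ i, ∑ D, boolSign (G D) * ∑ N, noiseWeight (Real.cos t) N *
        ((boolSign (N i) / (1 + boolSign (N i) * Real.cos t)) *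
          boolSign (G fun k => xor (D k) (N k))) := by
      simp only [hψ', prod_erase_eq_noiseWeight_div hc]
      rw [Finset.sum_comm (s := (univ : Finset (Fin n))), Finset.mul_sum]
      refine Finset.sum_congr rfl fun D _ => ?_
      simp only [Finset.mul_sum, Finset.sum_mul]
      rw [Finset.sum_comm]
      refine Finset.sum_congr rfl fun i _ => Finset.sum_congr rfl fun N _ => ?_
      ring
    rw [e, Real.norm_eq_abs, abs_mul, abs_neg]
    have h1 : (1 : ℝ) - Real.cos t ^ 2 = Real.sin t ^ 2 := by
      have := Real.sin_sq_add_cos_sq t; linarith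
    refine (mul_le_mul_of_nonneg_left (abs_sum_edge_score_le G J hJ hc) (abs_nonneg _)).trans ?_
    rw [h1, Real.sqrt_div zero_le_one, Real.sqrt_one, Real.sqrt_sq_eq_abs]
    have := (abs_pos.2 hs).ne'
    apply le_of_eq
    rw [← hM]
    field_simp
  have hmv := Convex.norm_image_sub_le_of_norm_hasDerivWithin_le (s := Set.univ)
    (fun t _ => (hder t).hasDerivWithinAt) (fun t _ => hbound t) convex_univ
    (Set.mem_univ Real.pi) (Set.mem_univ 0)
  have h0 : ψ 0 = ∑ D, boolSign (G D) * boolSign (G D) := by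
    simp only [hψ, Real.cos_zero, noiseWeight_one]
    simp
  have hpi : ψ Real.pi = ∑ D, boolSign (G D) * boolSign (G fun k => !D k) := by
    simp only [hψ, Real.cos_pi, noiseWeight_neg_one]
    simp
  have hdiff : ψ 0 - ψ Real.pi = 2 * (#{D | G D ≠ G fun i => !D i} : ℝ) := by
    rw [h0, hpi, ← Finset.sum_sub_distrib, Finset.card_filter]
    push_cast
    rw [Finset.mul_sum]
    refine Finset.sum_congr rfl fun D _ => ?_
    cases G D <;> cases G (fun k => !D k) <;> norm_num [boolSign]
  have := (le_abs_self _).trans hmv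
  rw [hdiff, zero_sub, norm_neg, Real.norm_eq_abs, abs_of_pos Real.pi_pos] at this
  linarith

/-- Sort `h` along coordinate `i`: the two values on each `i`-edge are put in increasing order. -/
def sortDir {n : ℕ} (i : Fin n) (h : (Fin n → Bool) → Bool) : (Fin n → Bool) → Bool := fun x =>
  if x i then h x || h (flipAt i x) else h x && h (flipAt i x)

/-- A Boolean function together with sets of directions charged at each point: `out x` for edges
leaving `x` upwards and `inn x` for edges entering `x` from below. -/
structure ChargedFun (n : ℕ) where
  /-- The underlying Boolean function. -/
  val : (Fin n → Bool) → Bool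
  /-- The directions of the upward edges charged at their lower endpoint. -/
  out : (Fin n → Bool) → Finset (Fin n)
  /-- The directions of the upward edges charged at their upper endpoint. -/
  inn : (Fin n → Bool) → Finset (Fin n)

/-- The Talagrand potential of a charged function. -/
noncomputable def ChargedFun.potential {n : ℕ} (s : ChargedFun n) : ℝ :=
  ∑ x, (Real.sqrt (#(s.out x)) + Real.sqrt (#(s.inn x)))

/-- Sorting a charged function along a coordinate; the charges follow the values, except that on
an edge with equal values they are replaced by their union and intersection. -/
def ChargedFun.sort {n : ℕ} (s : ChargedFun n) (i : Fin n) : ChargedFun n where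
  val := sortDir i s.val
  out x := if s.val x = s.val (flipAt i x) then
      (if x i then s.out x ∩ s.out (flipAt i x) else s.out x ∪ s.out (flipAt i x))
    else if s.val x = x i then s.out x else s.out (flipAt i x)
  inn x := if s.val x = s.val (flipAt i x) then
      (if x i then s.inn x ∪ s.inn (flipAt i x) else s.inn x ∩ s.inn (flipAt i x))
    else if s.val x = x i then s.inn x else s.inn (flipAt i x)

lemma sqrt_card_union_add_inter_le {α : Type*} [DecidableEq α] (A B : Finset α) :
    Real.sqrt (#(A ∪ B)) + Real.sqrt (#(A ∩ B)) ≤ Real.sqrt (#A) + Real.sqrt (#B) := by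
  have hc : (#(A ∪ B) : ℝ) + #(A ∩ B) = #A + #B := by
    exact_mod_cast Finset.card_union_add_card_inter A B
  have hA : (#(A ∩ B) : ℝ) ≤ #A := by exact_mod_cast Finset.card_le_card inter_subset_left
  have hB : (#(A ∩ B) : ℝ) ≤ #B := by exact_mod_cast Finset.card_le_card inter_subset_right
  generalize (#(A ∪ B) : ℝ) = u at *
  have hi : (0 : ℝ) ≤ #(A ∩ B) := by positivity
  generalize (#(A ∩ B) : ℝ) = v at *
  generalize (#A : ℝ) = a at *
  generalize (#B : ℝ) = b at *
  have hu : 0 ≤ u := by linarith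
  refine le_of_sq_le_sq ?_ (by positivity)
  have h1 : Real.sqrt u * Real.sqrt v ≤ Real.sqrt a * Real.sqrt b := by
    rw [← Real.sqrt_mul hu, ← Real.sqrt_mul (hi.trans hA)]
    apply Real.sqrt_le_sqrt
    nlinarith [mul_nonneg (sub_nonneg.2 hA) (sub_nonneg.2 hB)]
  have := Real.sq_sqrt hu
  have := Real.sq_sqrt hi
  have := Real.sq_sqrt (hi.trans hA)
  have := Real.sq_sqrt (hi.trans hB)
  nlinarith

lemma sum_le_sum_of_flipAt {n : ℕ} (i : Fin n) {φ ψ : (Fin n → Bool) → ℝ}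
    (h : ∀ x, φ x + φ (flipAt i x) ≤ ψ x + ψ (flipAt i x)) : ∑ x, φ x ≤ ∑ x, ψ x := by
  have := Finset.sum_le_sum fun x (_ : x ∈ univ) => h x
  rw [Finset.sum_add_distrib, Finset.sum_add_distrib, sum_flipAt, sum_flipAt] at this
  linarith

lemma ChargedFun.potential_sort_le {n : ℕ} (s : ChargedFun n) (i : Fin n) :
    (s.sort i).potential ≤ s.potential := by
  refine sum_le_sum_of_flipAt i fun x => ?_
  have h1 := sqrt_card_union_add_inter_le (s.out x) (s.out (flipAt i x))
  have h2 := sqrt_card_union_add_inter_le (s.inn x) (s.inn (flipAt i x))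
  have c1 : s.out (flipAt i x) ∪ s.out x = s.out x ∪ s.out (flipAt i x) := union_comm _ _
  have c2 : s.out (flipAt i x) ∩ s.out x = s.out x ∩ s.out (flipAt i x) := inter_comm _ _
  have c3 : s.inn (flipAt i x) ∪ s.inn x = s.inn x ∪ s.inn (flipAt i x) := union_comm _ _
  have c4 : s.inn (flipAt i x) ∩ s.inn x = s.inn x ∩ s.inn (flipAt i x) := inter_comm _ _
  simp only [ChargedFun.sort, flipAt_flipAt, flipAt_apply_self, c1, c2, c3, c4]
  cases hx : x i <;> cases hv : s.val x <;> cases hw : s.val (flipAt i x) <;>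
    simp <;> linarith

/-- The edges (in direction `j`) dropping from `s` at `x` to `t` at `y` are charged. -/
def Charges {n : ℕ} (j : Fin n) (s t : ChargedFun n) (x y : Fin n → Bool) : Prop :=
  s.val x = true → t.val y = false → j ∈ s.out x ∨ j ∈ t.inn y

lemma Charges.sort {n : ℕ} {i j : Fin n} {s t : ChargedFun n} {x y : Fin n → Bool}
    (hxy : x i = y i) (h : Charges j s t x y) (h' : Charges j s t (flipAt i x) (flipAt i y)) :
    Charges j (s.sort i) (t.sort i) x y := by
  unfold Charges at *
  simp only [ChargedFun.sort, sortDir]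
  rw [← hxy]
  cases hx : x i <;> cases hv : s.val x <;> cases hw : s.val (flipAt i x) <;>
    cases hv' : t.val y <;> cases hw' : t.val (flipAt i y) <;>
    simp_all <;> tauto

lemma Charges.self_sort {n : ℕ} {i : Fin n} {s : ChargedFun n}
    (h : ∀ x, x i = false → Charges i s s x (flipAt i x)) (x : Fin n → Bool) :
    Charges i s (s.sort i) x x := by
  have h1 := h x
  have h2 := h (flipAt i x)
  rw [flipAt_flipAt, flipAt_apply_self] at h2
  unfold Charges at *
  simp only [ChargedFun.sort, sortDir]
  cases hx : x i <;> cases hv : s.val x <;> cases hw : s.val (flipAt i x) <;>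
    simp_all

lemma Charges.sort_self {n : ℕ} {i : Fin n} {s : ChargedFun n}
    (h : ∀ x, x i = false → Charges i s s x (flipAt i x)) (x : Fin n → Bool) :
    Charges i (s.sort i) s x x := by
  have h1 := h x
  have h2 := h (flipAt i x)
  rw [flipAt_flipAt, flipAt_apply_self] at h2
  unfold Charges at *
  simp only [ChargedFun.sort, sortDir]
  cases hx : x i <;> cases hv : s.val x <;> cases hw : s.val (flipAt i x) <;>
    simp_all

/-- Sort a charged function along the coordinates of a list, in order. -/
def ChargedFun.sortList {n : ℕ} (L : List (Fin n)) (s : ChargedFun n) : ChargedFun n :=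
  L.foldl ChargedFun.sort s

/-- Sort a Boolean function along the coordinates of a list, in order. -/
def sortList {n : ℕ} (L : List (Fin n)) (h : (Fin n → Bool) → Bool) : (Fin n → Bool) → Bool :=
  L.foldl (fun h i => sortDir i h) h

lemma ChargedFun.val_sortList {n : ℕ} (L : List (Fin n)) (s : ChargedFun n) :
    (s.sortList L).val = _root_.sortList L s.val := by
  induction L generalizing s with
  | nil => rfl
  | cons i L ih => exact ih (s.sort i)

lemma ChargedFun.potential_sortList_le {n : ℕ} (L : List (Fin n)) (s : ChargedFun n) :
    (s.sortList L).potential ≤ s.potential := by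
  induction L generalizing s with
  | nil => exact le_rfl
  | cons i L ih => exact (ih (s.sort i)).trans (s.potential_sort_le i)

lemma flipAt_comm {n : ℕ} (i j : Fin n) (x : Fin n → Bool) :
    flipAt i (flipAt j x) = flipAt j (flipAt i x) := by
  by_cases h : i = j
  · rw [h]
  · funext k
    by_cases hi : k = i <;> by_cases hj : k = j <;> simp_all [flipAt]

lemma Charges.sortList_of_notMem {n : ℕ} {j : Fin n} {s : ChargedFun n}
    (h : ∀ x, x j = false → Charges j s s x (flipAt j x)) (L : List (Fin n)) (hL : j ∉ L) :
    ∀ x, x j = false → Charges j (s.sortList L) (s.sortList L) x (flipAt j x) := by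
  induction L generalizing s with
  | nil => exact h
  | cons i L ih =>
    simp only [List.mem_cons, not_or] at hL
    refine ih (s := s.sort i) (fun x hx => ?_) hL.2
    refine Charges.sort (flipAt_apply_of_ne (Ne.symm hL.1) x).symm (h x hx) ?_
    rw [flipAt_comm]
    exact h _ (by rwa [flipAt_apply_of_ne hL.1])

lemma Charges.sortList {n : ℕ} {j : Fin n} {s t : ChargedFun n} (h : ∀ x, Charges j s t x x)
    (L : List (Fin n)) (x : Fin n → Bool) : Charges j (s.sortList L) (t.sortList L) x x := by
  induction L generalizing s t with
  | nil => exact h x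
  | cons i L ih => exact ih (s := s.sort i) (t := t.sort i) fun x => Charges.sort rfl (h _) (h _)

lemma filter_flipAt_of_notMem {n : ℕ} {j : Fin n} {L : List (Fin n)} (hj : j ∉ L)
    (D : Fin n → Bool) : L.filter (flipAt j D) = L.filter D :=
  List.filter_congr fun _ hk => flipAt_apply_of_ne (ne_of_mem_of_not_mem hk hj) D

/-- Every direction in the list is charged when its membership in the sorted set is toggled. -/
lemma Charges.sortList_filter {n : ℕ} {j : Fin n} {s : ChargedFun n}
    (h : ∀ x, x j = false → Charges j s s x (flipAt j x)) (L : List (Fin n)) (hL : L.Nodup)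
    (hj : j ∈ L) (D : Fin n → Bool) (x : Fin n → Bool) :
    Charges j (s.sortList (L.filter D)) (s.sortList (L.filter (flipAt j D))) x x := by
  obtain ⟨L₁, L₂, rfl⟩ := List.append_of_mem hj
  have hn : j ∉ L₁ ∧ j ∉ L₂ := by
    rw [List.nodup_append] at hL
    refine ⟨fun h => hL.2.2 j h j (by simp) rfl, (List.nodup_cons.1 hL.2.1).1⟩
  have h1 := Charges.sortList_of_notMem h (L₁.filter D) (fun h => hn.1 (List.mem_of_mem_filter h))
  have happ : ∀ (A B : List (Fin n)), s.sortList (A ++ B) = (s.sortList A).sortList B :=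
    fun A B => List.foldl_append
  simp only [List.filter_append, List.filter_cons, filter_flipAt_of_notMem hn.1,
    filter_flipAt_of_notMem hn.2, flipAt_apply_self, happ]
  cases hD : D j
  · exact Charges.sortList (Charges.self_sort h1) (L₂.filter D) x
  · exact Charges.sortList (Charges.sort_self h1) (L₂.filter D) x

/-- Hamming distance between two Boolean functions on the cube, as a real number. -/
noncomputable def hdist {n : ℕ} (g h : (Fin n → Bool) → Bool) : ℝ := #{x | g x ≠ h x}

/-- Sorting along a random set and along its complement (within a list of directions whose
violated edges are charged) gives, on average, nearby functions. -/
theorem sum_hdist_sortList_le {n : ℕ} (s : ChargedFun n) (L : List (Fin n)) (hL : L.Nodup)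
    (h : ∀ j ∈ L, ∀ x, x j = false → Charges j s s x (flipAt j x)) :
    ∑ D : Fin n → Bool, hdist (sortList (L.filter D) s.val)
      (sortList (L.filter fun i => !D i) s.val) ≤ Real.pi * (2 ^ n * s.potential) := by
  set st : (Fin n → Bool) → ChargedFun n := fun D => s.sortList (L.filter D) with hst
  have hx : ∀ x, (#{D | (st D).val x ≠ (st fun i => !D i).val x} : ℝ) ≤ Real.pi *
      ∑ D, Real.sqrt (#(if (st D).val x then (st D).out x else (st D).inn x)) := by
    intro x
    refine card_ne_antipodal_le (fun D => (st D).val x)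
      (fun D => if (st D).val x then (st D).out x else (st D).inn x) fun D i hne => ?_
    by_cases hi : i ∈ L
    · have c1 := Charges.sortList_filter (h i hi) L hL hi D x
      have c2 := Charges.sortList_filter (h i hi) L hL hi (flipAt i D) x
      rw [flipAt_flipAt] at c2
      simp only [hst] at *
      unfold Charges at c1 c2
      revert hne c1 c2
      cases h1 : (s.sortList (L.filter D)).val x <;>
        cases h2 : (s.sortList (L.filter (flipAt i D))).val x <;> (simp; try tauto)
    · exact absurd (by simp only [hst, filter_flipAt_of_notMem hi]) hne
  have hsum : ∑ D : Fin n → Bool, hdist (sortList (L.filter D) s.val)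
      (sortList (L.filter fun i => !D i) s.val)
      = ∑ x, (#{D | (st D).val x ≠ (st fun i => !D i).val x} : ℝ) := by
    simp only [hdist, Finset.card_filter, hst, ChargedFun.val_sortList]
    push_cast
    rw [Finset.sum_comm]
  rw [hsum]
  refine (Finset.sum_le_sum fun x _ => hx x).trans ?_
  rw [← Finset.mul_sum, Finset.sum_comm]
  refine mul_le_mul_of_nonneg_left ?_ Real.pi_pos.le
  have hD : ∀ D, ∑ x, Real.sqrt (#(if (st D).val x then (st D).out x else (st D).inn x))
      ≤ s.potential := by
    intro D
    refine le_trans (Finset.sum_le_sum fun x _ => ?_) (s.potential_sortList_le (L.filter D))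
    split_ifs
    · exact le_add_of_nonneg_right (Real.sqrt_nonneg _)
    · exact le_add_of_nonneg_left (Real.sqrt_nonneg _)
  refine (Finset.sum_le_sum fun D _ => hD D).trans ?_
  simp

lemma hdist_triangle {n : ℕ} (f g h : (Fin n → Bool) → Bool) :
    hdist f h ≤ hdist f g + hdist g h := by
  unfold hdist
  norm_cast
  refine (Finset.card_le_card fun x hx => ?_).trans (Finset.card_union_le _ _)
  simp only [mem_filter_univ, mem_union] at *
  by_contra! hc
  exact hx (hc.1.trans hc.2)

lemma hdist_sortDir_le {n : ℕ} (i : Fin n) (g h : (Fin n → Bool) → Bool) :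
    hdist (sortDir i g) (sortDir i h) ≤ hdist g h := by
  simp only [hdist, Finset.card_filter]
  push_cast
  refine sum_le_sum_of_flipAt i fun x => ?_
  simp only [sortDir, flipAt_flipAt, flipAt_apply_self]
  rcases (x i).eq_false_or_eq_true with hx | hx <;>
    rcases (g x).eq_false_or_eq_true with h1 | h1 <;>
    rcases (g (flipAt i x)).eq_false_or_eq_true with h2 | h2 <;>
    rcases (h x).eq_false_or_eq_true with h3 | h3 <;>
    rcases (h (flipAt i x)).eq_false_or_eq_true with h4 | h4 <;>
    norm_num [hx, h1, h2, h3, h4]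

lemma hdist_sortList_le {n : ℕ} (L : List (Fin n)) (g h : (Fin n → Bool) → Bool) :
    hdist (sortList L g) (sortList L h) ≤ hdist g h := by
  induction L generalizing g h with
  | nil => exact le_rfl
  | cons i L ih => exact (ih _ _).trans (hdist_sortDir_le i g h)

/-- `h` is nondecreasing along every edge in direction `i`. -/
def MonoDir {n : ℕ} (i : Fin n) (h : (Fin n → Bool) → Bool) : Prop :=
  ∀ x, x i = false → h x = true → h (flipAt i x) = true

lemma monoDir_sortDir_self {n : ℕ} (i : Fin n) (h : (Fin n → Bool) → Bool) :
    MonoDir i (sortDir i h) := by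
  intro x hx
  simp only [sortDir, flipAt_flipAt, flipAt_apply_self, hx]
  cases h x <;> simp

lemma MonoDir.sortDir {n : ℕ} {j : Fin n} {h : (Fin n → Bool) → Bool} (hj : MonoDir j h)
    (i : Fin n) : MonoDir j (sortDir i h) := by
  by_cases hij : i = j
  · exact hij ▸ monoDir_sortDir_self i h
  intro x hx
  have h1 := hj x hx
  have h2 := hj (flipAt i x) (by rwa [flipAt_apply_of_ne (Ne.symm hij)])
  simp only [_root_.sortDir, flipAt_apply_of_ne hij]
  rw [flipAt_comm] at h2
  cases x i <;> simp <;> tauto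

lemma MonoDir.sortDir_eq {n : ℕ} {i : Fin n} {h : (Fin n → Bool) → Bool} (hi : MonoDir i h) :
    _root_.sortDir i h = h := by
  funext x
  have h1 := hi x
  have h2 := hi (flipAt i x)
  rw [flipAt_flipAt, flipAt_apply_self] at h2
  simp only [_root_.sortDir]
  cases hx : x i <;> cases hv : h x <;> simp_all

lemma MonoDir.sortList {n : ℕ} {j : Fin n} (L : List (Fin n)) {h : (Fin n → Bool) → Bool}
    (hj : MonoDir j h) : MonoDir j (sortList L h) := by
  induction L generalizing h with
  | nil => exact hj
  | cons i L ih => exact ih (hj.sortDir i)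

lemma monoDir_sortList {n : ℕ} {j : Fin n} {L : List (Fin n)} (hL : j ∈ L)
    (h : (Fin n → Bool) → Bool) : MonoDir j (sortList L h) := by
  induction L generalizing h with
  | nil => simp at hL
  | cons i L ih =>
    rcases List.mem_cons.1 hL with rfl | hj
    · exact MonoDir.sortList L (monoDir_sortDir_self j h)
    · exact ih hj _

lemma sortList_eq_self {n : ℕ} {L : List (Fin n)} {h : (Fin n → Bool) → Bool}
    (hL : ∀ j ∈ L, MonoDir j h) : sortList L h = h := by
  induction L with
  | nil => rfl
  | cons i L ih =>
    have : sortDir i h = h := (hL i (by simp)).sortDir_eq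
    change sortList L (sortDir i h) = h
    rw [this]
    exact ih fun j hj => hL j (by simp [hj])

lemma sortList_append {n : ℕ} (L₁ L₂ : List (Fin n)) (h : (Fin n → Bool) → Bool) :
    sortList (L₁ ++ L₂) h = sortList L₂ (sortList L₁ h) := List.foldl_append

lemma hdist_sortList_append_le {n : ℕ} (L₁ L₂ : List (Fin n)) (h : (Fin n → Bool) → Bool) :
    hdist h (sortList (L₁ ++ L₂) h)
      ≤ hdist h (sortList L₂ h) + hdist (sortList L₂ h) (sortList L₁ h) := by
  have h1 := hdist_sortList_le L₂ (sortList L₂ h) (sortList L₁ h)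
  rw [sortList_eq_self fun j hj => monoDir_sortList hj h, ← sortList_append] at h1
  exact (hdist_triangle _ _ _).trans (add_le_add_right h1 _)

lemma monotone_of_monoDir {n : ℕ} {h : (Fin n → Bool) → Bool} (hm : ∀ i, MonoDir i h) :
    Monotone h := by
  suffices H : ∀ (k : ℕ) (x y : Fin n → Bool), x ≤ y → #{i | x i ≠ y i} = k → h x ≤ h y from
    fun x y hxy => H _ x y hxy rfl
  intro k
  induction k with
  | zero =>
    intro x y _ hk
    have : x = y := by
      funext i
      by_contra hne
      have := Finset.card_eq_zero.1 hk
      exact absurd (Finset.mem_filter_univ i |>.2 hne) (by rw [this]; simp)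
    rw [this]
  | succ k ih =>
    intro x y hxy hk
    obtain ⟨i, hi⟩ := Finset.card_pos.1 (by rw [hk]; exact Nat.succ_pos k)
    rw [Finset.mem_filter_univ] at hi
    have hxi : x i = false ∧ y i = true := by
      have := hxy i
      revert this hi
      cases x i <;> cases y i <;> simp
    have h1 : h x ≤ h (flipAt i x) := hm i x hxi.1
    refine h1.trans (ih _ _ (fun j => ?_) ?_)
    · by_cases hj : j = i
      · subst hj
        simp [hxi.2]
      · rw [flipAt_apply_of_ne hj]; exact hxy j
    · have : ({j | flipAt i x j ≠ y j} : Finset (Fin n)) =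
          ({j | x j ≠ y j} : Finset _).erase i := by
        ext j
        by_cases hj : j = i
        · subst hj
          simp [flipAt_apply_self, hxi]
        · simp [flipAt_apply_of_ne hj, hj]
      rw [this, Finset.card_erase_of_mem (by simpa using hi), hk]
      rfl

/-- The mean of a function of `K` independent uniform points of the cube. -/
noncomputable def cubeMean {n : ℕ} : ℕ → (List (Fin n → Bool) → ℝ) → ℝ
  | 0, φ => φ []
  | K + 1, φ => (∑ B, cubeMean K fun l => φ (B :: l)) / 2 ^ n

lemma cubeMean_mono {n : ℕ} (K : ℕ) {φ ψ : List (Fin n → Bool) → ℝ} (h : ∀ l, φ l ≤ ψ l) :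
    cubeMean K φ ≤ cubeMean K ψ := by
  induction K generalizing φ ψ with
  | zero => exact h []
  | succ K ih =>
    simp only [cubeMean]
    gcongr with B
    exact ih fun l => h _

lemma cubeMean_const {n : ℕ} (K : ℕ) (c : ℝ) :
    cubeMean K (fun _ : List (Fin n → Bool) => c) = c := by
  induction K with
  | zero => rfl
  | succ K ih => simp [cubeMean, ih]

lemma cubeMean_add {n : ℕ} (K : ℕ) (φ ψ : List (Fin n → Bool) → ℝ) :
    cubeMean K (fun l => φ l + ψ l) = cubeMean K φ + cubeMean K ψ := by
  induction K generalizing φ ψ with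
  | zero => rfl
  | succ K ih => simp only [cubeMean, ih, Finset.sum_add_distrib, add_div]

lemma sum_cubeMean {n : ℕ} {ι : Type*} [Fintype ι] (K : ℕ) (φ : ι → List (Fin n → Bool) → ℝ) :
    ∑ b, cubeMean K (φ b) = cubeMean K fun l => ∑ b, φ b l := by
  induction K generalizing φ with
  | zero => rfl
  | succ K ih =>
    simp only [cubeMean, ← ih]
    rw [← Finset.sum_div, Finset.sum_comm]

/-- The order of the coordinates determined by a list of points, each read as a string of bits:
coordinates with bit `false` come first, ties being broken by the remaining points. -/
def lexOrder {n : ℕ} : List (Fin n → Bool) → List (Fin n)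
  | [] => List.finRange n
  | B :: l => (lexOrder l).filter (fun i => !B i) ++ (lexOrder l).filter B

lemma mem_lexOrder {n : ℕ} (l : List (Fin n → Bool)) (i : Fin n) : i ∈ lexOrder l := by
  induction l with
  | nil => simp [lexOrder]
  | cons B l ih => cases h : B i <;> simp [lexOrder, ih, h]

lemma nodup_lexOrder {n : ℕ} (l : List (Fin n → Bool)) : (lexOrder l).Nodup := by
  induction l with
  | nil => exact List.nodup_finRange n
  | cons B l ih =>
    refine List.Nodup.append (ih.filter _) (ih.filter _) fun i h1 h2 => ?_
    simp [List.mem_filter] at h1 h2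
    simp_all

/-- Restriction of the charges to a set of directions. -/
def ChargedFun.restrict {n : ℕ} (s : ChargedFun n) (Q : Fin n → Bool) : ChargedFun n where
  val := s.val
  out x := (s.out x).filter (fun i => Q i = true)
  inn x := (s.inn x).filter (fun i => Q i = true)

lemma sum_card_filter_cube {n : ℕ} (A : Finset (Fin n)) :
    ∑ B : Fin n → Bool, (#(A.filter (fun i => B i = true)) : ℝ) = 2 ^ n * (#A / 2) := by
  have h : ∀ i : Fin n, ∑ B : Fin n → Bool, (if B i = true then (1 : ℝ) else 0) = 2 ^ n / 2 := by
    intro i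
    have h1 := sum_flipAt i fun B : Fin n → Bool => if B i = true then (1 : ℝ) else 0
    have h2 : ∑ B : Fin n → Bool, ((if B i = true then (1 : ℝ) else 0) +
        (if flipAt i B i = true then (1 : ℝ) else 0)) = 2 ^ n := by
      have : ∀ B : Fin n → Bool, ((if B i = true then (1 : ℝ) else 0) +
        (if flipAt i B i = true then (1 : ℝ) else 0)) = 1 := by
        intro B
        rw [flipAt_apply_self]
        cases B i <;> simp
      simp [this]
    rw [Finset.sum_add_distrib, h1] at h2
    linarith
  simp only [Finset.card_filter]
  push_cast
  rw [Finset.sum_comm, Finset.sum_congr rfl fun i _ => h i]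
  simp
  ring

lemma sum_sqrt_card_filter_le {n : ℕ} (A : Finset (Fin n)) :
    ∑ B : Fin n → Bool, Real.sqrt (#(A.filter (fun i => B i = true)))
      ≤ 2 ^ n * (3 / 4 * Real.sqrt (#A)) := by
  refine le_of_sq_le_sq ?_ (by positivity)
  have h := sq_sum_le_card_mul_sum_sq (s := (univ : Finset (Fin n → Bool)))
    (f := fun B => Real.sqrt (#(A.filter (fun i => B i = true))))
  simp only [Real.sq_sqrt (Nat.cast_nonneg _)] at h
  rw [sum_card_filter_cube] at h
  simp only [card_univ, Fintype.card_pi, Fintype.card_bool, prod_const, Fintype.card_fin,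
    Nat.cast_pow, Nat.cast_ofNat] at h
  refine h.trans ?_
  rw [mul_pow, mul_pow, Real.sq_sqrt (Nat.cast_nonneg _)]
  have : (0 : ℝ) ≤ (2 ^ n) ^ 2 * #A := by positivity
  nlinarith

lemma ChargedFun.sum_potential_restrict_le {n : ℕ} (s : ChargedFun n) (Q : Fin n → Bool) :
    ∑ B : Fin n → Bool, (s.restrict fun i => Q i && B i).potential
      ≤ 2 ^ n * (3 / 4 * (s.restrict Q).potential) := by
  unfold ChargedFun.potential
  rw [Finset.sum_comm]
  simp only [Finset.mul_sum]
  refine Finset.sum_le_sum fun x _ => ?_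
  rw [Finset.sum_add_distrib, mul_add, mul_add]
  refine add_le_add ?_ ?_
  · refine le_trans (le_of_eq ?_) (sum_sqrt_card_filter_le ((s.restrict Q).out x))
    simp only [ChargedFun.restrict, Finset.filter_filter, Bool.and_eq_true]
  · refine le_trans (le_of_eq ?_) (sum_sqrt_card_filter_le ((s.restrict Q).inn x))
    simp only [ChargedFun.restrict, Finset.filter_filter, Bool.and_eq_true]

lemma hdist_le {n : ℕ} (g h : (Fin n → Bool) → Bool) : hdist g h ≤ 2 ^ n := by
  have := Finset.card_le_univ ({x | g x ≠ h x} : Finset (Fin n → Bool))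
  simp only [Fintype.card_pi, Fintype.card_bool, prod_const, card_univ, Fintype.card_fin] at this
  unfold hdist
  exact_mod_cast this

theorem cubeMean_hdist_sortList_le {n : ℕ} (s : ChargedFun n)
    (h : ∀ j x, x j = false → Charges j s s x (flipAt j x)) (K : ℕ) (Q : Fin n → Bool) :
    cubeMean K (fun l => hdist s.val (sortList ((lexOrder l).filter Q) s.val))
      ≤ 4 * Real.pi * (s.restrict Q).potential
        + 2 ^ n * #(univ.filter fun i => Q i = true) / 2 ^ K := by
  have hpot : ∀ Q, 0 ≤ (s.restrict Q).potential := fun Q =>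
    Finset.sum_nonneg fun x _ => by positivity
  induction K generalizing Q with
  | zero =>
    simp only [cubeMean, pow_zero, div_one]
    refine le_add_of_nonneg_of_le (mul_nonneg (by positivity) (hpot Q)) ?_
    by_cases hQ : univ.filter (fun i => Q i = true) = ∅
    · have : (lexOrder []).filter Q = [] := by
        rw [List.filter_eq_nil_iff]
        intro i _
        have := Finset.filter_eq_empty_iff.1 hQ (mem_univ i)
        simpa using this
      rw [this]
      simp [sortList, hdist]
    · refine (hdist_le _ _).trans (le_mul_of_one_le_right (by positivity) ?_)
      exact_mod_cast Finset.card_pos.2 (Finset.nonempty_iff_ne_empty.2 hQ)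
  | succ K ih =>
    set δ : (Fin n → Bool) → List (Fin n → Bool) → ℝ := fun B l =>
      hdist (sortList (((lexOrder l).filter Q).filter B) s.val)
        (sortList (((lexOrder l).filter Q).filter fun i => !B i) s.val) with hδ
    have hstep : ∀ B l, hdist s.val (sortList ((lexOrder (B :: l)).filter Q) s.val)
        ≤ hdist s.val (sortList ((lexOrder l).filter fun i => Q i && B i) s.val) + δ B l := by
      intro B l
      have e1 : (lexOrder (B :: l)).filter Q = ((lexOrder l).filter Q).filter (fun i => !B i) ++
          ((lexOrder l).filter Q).filter B := by
        simp only [lexOrder, List.filter_append, List.filter_filter]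
        congr 1 <;> exact List.filter_congr fun i _ => Bool.and_comm _ _
      have e2 : ((lexOrder l).filter fun i => Q i && B i) = ((lexOrder l).filter Q).filter B := by
        rw [List.filter_filter]
        exact List.filter_congr fun i _ => Bool.and_comm _ _
      rw [e1, e2]
      exact hdist_sortList_append_le _ _ _
    have hδsum : ∀ l, ∑ B, δ B l ≤ Real.pi * (2 ^ n * (s.restrict Q).potential) := by
      intro l
      refine sum_hdist_sortList_le (s.restrict Q) ((lexOrder l).filter Q)
        ((nodup_lexOrder l).filter _) fun j hj x hx hv hw => ?_
      have hQ : Q j = true := (List.mem_filter.1 hj).2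
      exact (h j x hx hv hw).imp (fun h => mem_filter.2 ⟨h, hQ⟩) (fun h => mem_filter.2 ⟨h, hQ⟩)
    have hδmean : ∑ B, cubeMean K (δ B) ≤ Real.pi * (2 ^ n * (s.restrict Q).potential) := by
      rw [sum_cubeMean]
      exact (cubeMean_mono K hδsum).trans (cubeMean_const K _).le
    have hmain : ∑ B : Fin n → Bool, cubeMean K (fun l => hdist s.val
        (sortList ((lexOrder l).filter fun i => Q i && B i) s.val))
        ≤ 4 * Real.pi * (2 ^ n * (3 / 4 * (s.restrict Q).potential)) +
          2 ^ n * (2 ^ n * (#(univ.filter fun i => Q i = true) / 2)) / 2 ^ K := by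
      refine (Finset.sum_le_sum fun B _ => ih fun i => Q i && B i).trans ?_
      rw [Finset.sum_add_distrib, ← Finset.mul_sum, ← Finset.sum_div, ← Finset.mul_sum]
      gcongr
      · exact s.sum_potential_restrict_le Q
      · rw [← sum_card_filter_cube]
        simp only [Finset.filter_filter, Bool.and_eq_true]
        exact le_rfl
    simp only [cubeMean]
    rw [div_le_iff₀ (by positivity)]
    calc ∑ B : Fin n → Bool, cubeMean K (fun l => hdist s.val
          (sortList ((lexOrder (B :: l)).filter Q) s.val))
        ≤ ∑ B : Fin n → Bool, (cubeMean K (fun l => hdist s.val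
            (sortList ((lexOrder l).filter fun i => Q i && B i) s.val)) + cubeMean K (δ B)) := by
          refine Finset.sum_le_sum fun B _ => ?_
          rw [← cubeMean_add]
          exact cubeMean_mono K (hstep B)
      _ ≤ _ := by
          rw [Finset.sum_add_distrib]
          refine (add_le_add hmain hδmean).trans (le_of_eq ?_)
          field_simp
          ring

/-- The robust directed Talagrand inequality for Boolean functions. -/
theorem exists_monotone_hdist_le {n : ℕ} (s : ChargedFun n)
    (h : ∀ j x, x j = false → Charges j s s x (flipAt j x)) :
    ∃ g : (Fin n → Bool) → Bool, Monotone g ∧ hdist s.val g ≤ 4 * Real.pi * s.potential := by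
  classical
  obtain ⟨g, hg, hmin⟩ := Finset.exists_min_image
    ({g | Monotone g} : Finset ((Fin n → Bool) → Bool)) (hdist s.val)
    ⟨fun _ => false, by simp [monotone_const]⟩
  rw [mem_filter_univ] at hg
  refine ⟨g, hg, ?_⟩
  have hK : ∀ K : ℕ, hdist s.val g ≤ 4 * Real.pi * s.potential + 2 ^ n * n / 2 ^ K := by
    intro K
    have h1 := cubeMean_hdist_sortList_le s h K (fun _ => true)
    have h2 : (s.restrict fun _ => true) = s := by simp [ChargedFun.restrict]
    rw [h2] at h1
    simp only [Finset.filter_true, card_univ, Fintype.card_fin] at h1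
    refine le_trans ?_ h1
    rw [← cubeMean_const (n := n) K (hdist s.val g)]
    refine cubeMean_mono K fun l => hmin _ ?_
    rw [mem_filter_univ]
    exact monotone_of_monoDir fun i => monoDir_sortList
      (List.mem_filter.2 ⟨mem_lexOrder l i, rfl⟩) _
  refine ge_of_tendsto' (x := Filter.atTop) ?_ hK
  have := (tendsto_pow_atTop_nhds_zero_of_lt_one (r := (1 / 2 : ℝ)) (by norm_num)
    (by norm_num)).const_mul ((2 : ℝ) ^ n * n)
  have := this.const_add (4 * Real.pi * s.potential)
  simpa [div_eq_mul_inv] using this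

lemma card_le_card_of_sum_abs_le {α : Type*} [Fintype α] [DecidableEq α] {f g g' : α → ℝ}
    (hopt : ∑ x, |f x - g x| ≤ ∑ x, |f x - g' x|) {δ : ℝ} (hδ : 0 < δ) {S T : Finset α}
    (hST : ∀ x ∈ S, x ∉ T) (hS : ∀ x ∈ S, |f x - g' x| ≤ |f x - g x| - δ)
    (hT : ∀ x ∈ T, |f x - g' x| ≤ |f x - g x| + δ)
    (heq : ∀ x, x ∉ S → x ∉ T → g' x = g x) : #S ≤ #T := by
  have h1 : ∀ x, |f x - g' x| ≤
      |f x - g x| + ((if x ∈ T then δ else 0) - if x ∈ S then δ else 0) := by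
    intro x
    by_cases hxS : x ∈ S
    · rw [if_pos hxS, if_neg (hST x hxS)]
      linarith [hS x hxS]
    by_cases hxT : x ∈ T
    · rw [if_neg hxS, if_pos hxT]
      linarith [hT x hxT]
    · rw [if_neg hxS, if_neg hxT, heq x hxS hxT]
      simp
  have h2 := hopt.trans (Finset.sum_le_sum fun x _ => h1 x)
  rw [Finset.sum_add_distrib, Finset.sum_sub_distrib, Finset.sum_ite_mem, Finset.sum_ite_mem] at h2
  simp only [univ_inter, sum_const, nsmul_eq_mul] at h2
  have h3 : (#S : ℝ) * δ ≤ #T * δ := by linarith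
  exact_mod_cast le_of_mul_le_mul_right h3 hδ

/-- A level set of a monotone `g`, split by an upward closed property of the values of `f`, is
close to a monotone Boolean function. -/
lemma exists_monotone_hdist_level_le {n : ℕ} {f g : (Fin n → Bool) → ℝ} (hg : Monotone g)
    {R B : (Fin n → Bool) → Finset (Fin n)}
    (hRB : ∀ j x, x j = false → f (flipAt j x) < f x → j ∈ R x ∨ j ∈ B (flipAt j x))
    (v : ℝ) {p : ℝ → Prop} (hp : ∀ a b, a ≤ b → p a → p b) {F : (Fin n → Bool) → Bool}
    (hF : ∀ x, F x = true ↔ v < g x ∨ g x = v ∧ p (f x)) :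
    ∃ h : (Fin n → Bool) → Bool, Monotone h ∧ hdist F h ≤ 4 * Real.pi *
      ∑ x, if g x = v then Real.sqrt (#(R x)) + Real.sqrt (#(B x)) else 0 := by
  let s : ChargedFun n :=
    { val := F
      out := fun x => if g x = v then R x else ∅
      inn := fun x => if g x = v then B x else ∅ }
  obtain ⟨h, hh, hd⟩ := exists_monotone_hdist_le s fun j x hx hv hw => by
    have hle : g x ≤ g (flipAt j x) := by
      refine hg fun i => ?_
      by_cases hi : i = j
      · rw [hi, hx]
        exact Bool.false_le _
      · rw [flipAt_apply_of_ne hi]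
    have h1 := (hF x).1 hv
    have h2 : ¬(v < g (flipAt j x) ∨ g (flipAt j x) = v ∧ p (f (flipAt j x))) := by
      rw [← hF]
      exact ne_true_of_eq_false hw
    rw [not_or, not_lt, not_and] at h2
    have hgx : g x = v ∧ p (f x) := h1.resolve_left (not_lt.2 (hle.trans h2.1))
    have hgy : g (flipAt j x) = v := le_antisymm h2.1 (hgx.1 ▸ hle)
    have hlt : f (flipAt j x) < f x := by
      by_contra! hc
      exact h2.2 hgy (hp _ _ hc hgx.2)
    simp only [s, hgx.1, hgy, if_true]
    exact hRB j x hx hlt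
  refine ⟨h, hh, hd.trans (le_of_eq ?_)⟩
  congr 1
  refine Finset.sum_congr rfl fun x _ => ?_
  by_cases hx : g x = v <;> simp [s, hx]

section Optimal

variable {n : ℕ} {f g : (Fin n → Bool) → ℝ} {V : Finset ℝ}

lemma card_lt_le_hdist (hg : Monotone g) (hgV : ∀ x, g x ∈ V) (hfV : ∀ x, f x ∈ V)
    (hopt : ∀ g', Monotone g' → (∀ x, g' x ∈ V) → ∑ x, |f x - g x| ≤ ∑ x, |f x - g' x|)
    {v : ℝ} {F h : (Fin n → Bool) → Bool} (hF : ∀ x, F x = true ↔ v < g x ∨ g x = v ∧ v < f x)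
    (hh : Monotone h) : (#{x | g x = v ∧ v < f x} : ℝ) ≤ hdist F h := by
  by_cases hV : (V.filter (v < ·)).Nonempty
  swap
  · have : #{x | g x = v ∧ v < f x} = 0 := by
      rw [Finset.card_eq_zero, Finset.filter_eq_empty_iff]
      rintro x - ⟨-, hx⟩
      exact hV ⟨f x, mem_filter.2 ⟨hfV x, hx⟩⟩
    rw [this, Nat.cast_zero]
    exact Nat.cast_nonneg _
  obtain ⟨w, hw, hmin⟩ := (V.filter (v < ·)).exists_min_image id hV
  rw [mem_filter] at hw
  have hnext : ∀ u ∈ V, v < u → w ≤ u := fun u hu hvu => hmin u (mem_filter.2 ⟨hu, hvu⟩)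
  have hcard := card_le_card_of_sum_abs_le
    (g' := fun x => if g x = v ∧ h x = true then w else g x)
    (S := {x | g x = v ∧ h x = true ∧ v < f x}) (T := {x | g x = v ∧ h x = true ∧ ¬v < f x})
    (hopt _ ?_ ?_) (sub_pos.2 hw.2) ?_ ?_ ?_ ?_
  · have hsub : #{x | g x = v ∧ v < f x} ≤ #{x | g x = v ∧ h x = true ∧ v < f x}
        + #{x | g x = v ∧ ¬h x = true ∧ v < f x} := by
      refine (Finset.card_le_card fun x hx => ?_).trans (Finset.card_union_le _ _)
      simp only [mem_union, mem_filter_univ] at *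
      tauto
    have hdis : #{x | g x = v ∧ h x = true ∧ ¬v < f x}
        + #{x | g x = v ∧ ¬h x = true ∧ v < f x} ≤ #{x | F x ≠ h x} := by
      rw [← Finset.card_union_of_disjoint]
      · refine Finset.card_le_card fun x hx => ?_
        simp only [mem_union, mem_filter_univ] at *
        intro he
        have := hF x
        rw [he] at this
        rcases hx with ⟨h1, h2, h3⟩ | ⟨h1, h2, h3⟩
        · rw [h1] at this
          have := this.1 h2
          simp_all
        · exact h2 (this.2 (Or.inr ⟨h1, h3⟩))
      · rw [Finset.disjoint_left]
        intro x h1 h2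
        rw [mem_filter_univ] at h1 h2
        exact h2.2.1 h1.2.1
    unfold hdist
    exact Nat.cast_le.2 (by omega)
  · intro x y hxy
    have hgxy := hg hxy
    have hhxy : h x = true → h y = true := hh hxy
    dsimp only
    split_ifs with h1 h2 h2
    · exact le_rfl
    · rcases hgxy.lt_or_eq with hlt | heq
      · exact hnext _ (hgV y) (h1.1 ▸ hlt)
      · exact absurd ⟨heq ▸ h1.1, hhxy h1.2⟩ h2
    · exact hgxy.trans (h2.1.le.trans hw.2.le)
    · exact hgxy
  · intro x
    split_ifs
    · exact hw.1
    · exact hgV x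
  · intro x hx
    rw [mem_filter_univ] at *
    tauto
  · intro x hx
    rw [mem_filter_univ] at hx
    rw [if_pos ⟨hx.1, hx.2.1⟩, hx.1, abs_of_nonneg (sub_nonneg.2 hx.2.2.le),
      abs_of_nonneg (sub_nonneg.2 (hnext _ (hfV x) hx.2.2))]
    linarith
  · intro x hx
    rw [mem_filter_univ] at hx
    rw [if_pos ⟨hx.1, hx.2.1⟩, hx.1]
    have := abs_add_le (f x - v) (v - w)
    rw [abs_of_nonpos (sub_nonpos.2 hw.2.le)] at this
    simpa using this
  · intro x h1 h2
    rw [mem_filter_univ] at h1 h2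
    exact if_neg fun hc => by tauto

lemma card_gt_le_hdist (hg : Monotone g) (hgV : ∀ x, g x ∈ V) (hfV : ∀ x, f x ∈ V)
    (hopt : ∀ g', Monotone g' → (∀ x, g' x ∈ V) → ∑ x, |f x - g x| ≤ ∑ x, |f x - g' x|)
    {v : ℝ} {F h : (Fin n → Bool) → Bool} (hF : ∀ x, F x = true ↔ v < g x ∨ g x = v ∧ v ≤ f x)
    (hh : Monotone h) : (#{x | g x = v ∧ f x < v} : ℝ) ≤ hdist F h := by
  by_cases hV : (V.filter (· < v)).Nonempty
  swap
  · have : #{x | g x = v ∧ f x < v} = 0 := by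
      rw [Finset.card_eq_zero, Finset.filter_eq_empty_iff]
      rintro x - ⟨-, hx⟩
      exact hV ⟨f x, mem_filter.2 ⟨hfV x, hx⟩⟩
    rw [this, Nat.cast_zero]
    exact Nat.cast_nonneg _
  obtain ⟨w, hw, hmax⟩ := (V.filter (· < v)).exists_max_image id hV
  rw [mem_filter] at hw
  have hprev : ∀ u ∈ V, u < v → u ≤ w := fun u hu hvu => hmax u (mem_filter.2 ⟨hu, hvu⟩)
  have hcard := card_le_card_of_sum_abs_le
    (g' := fun x => if g x = v ∧ ¬h x = true then w else g x)
    (S := {x | g x = v ∧ ¬h x = true ∧ f x < v}) (T := {x | g x = v ∧ ¬h x = true ∧ ¬f x < v})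
    (hopt _ ?_ ?_) (sub_pos.2 hw.2) ?_ ?_ ?_ ?_
  · have hsub : #{x | g x = v ∧ f x < v} ≤ #{x | g x = v ∧ ¬h x = true ∧ f x < v}
        + #{x | g x = v ∧ h x = true ∧ f x < v} := by
      refine (Finset.card_le_card fun x hx => ?_).trans (Finset.card_union_le _ _)
      simp only [mem_union, mem_filter_univ] at *
      tauto
    have hdis : #{x | g x = v ∧ ¬h x = true ∧ ¬f x < v}
        + #{x | g x = v ∧ h x = true ∧ f x < v} ≤ #{x | F x ≠ h x} := by
      rw [← Finset.card_union_of_disjoint]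
      · refine Finset.card_le_card fun x hx => ?_
        simp only [mem_union, mem_filter_univ] at *
        intro he
        have := hF x
        rw [he] at this
        rcases hx with ⟨h1, h2, h3⟩ | ⟨h1, h2, h3⟩
        · exact h2 (this.2 (Or.inr ⟨h1, not_lt.1 h3⟩))
        · have := this.1 h2
          rw [h1] at this
          rcases this with h4 | h4
          · exact lt_irrefl _ h4
          · exact absurd h3 (not_lt.2 h4.2)
      · rw [Finset.disjoint_left]
        intro x h1 h2
        rw [mem_filter_univ] at h1 h2
        exact h1.2.1 h2.2.1
    unfold hdist
    exact Nat.cast_le.2 (by omega)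
  · intro x y hxy
    have hgxy := hg hxy
    have hhxy : h x = true → h y = true := hh hxy
    dsimp only
    split_ifs with h1 h2 h2
    · exact le_rfl
    · exact (hw.2.le.trans h1.1.ge).trans hgxy
    · rcases hgxy.lt_or_eq with hlt | heq
      · exact hprev _ (hgV x) (h2.1 ▸ hlt)
      · exact absurd ⟨heq.trans h2.1, fun hc => h2.2 (hhxy hc)⟩ h1
    · exact hgxy
  · intro x
    split_ifs
    · exact hw.1
    · exact hgV x
  · intro x hx
    rw [mem_filter_univ] at *
    tauto
  · intro x hx
    rw [mem_filter_univ] at hx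
    rw [if_pos ⟨hx.1, hx.2.1⟩, hx.1, abs_of_nonpos (sub_nonpos.2 hx.2.2.le),
      abs_of_nonpos (sub_nonpos.2 (hprev _ (hfV x) hx.2.2))]
    linarith
  · intro x hx
    rw [mem_filter_univ] at hx
    rw [if_pos ⟨hx.1, hx.2.1⟩, hx.1]
    have := abs_add_le (f x - v) (v - w)
    rw [abs_of_nonneg (sub_nonneg.2 hw.2.le)] at this
    simpa using this
  · intro x h1 h2
    rw [mem_filter_univ] at h1 h2
    exact if_neg fun hc => by tauto

lemma exists_monotone_sum_abs_le (f : (Fin n → Bool) → ℝ) (hV : V.Nonempty) :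
    ∃ g, Monotone g ∧ (∀ x, g x ∈ V) ∧
      ∀ g', Monotone g' → (∀ x, g' x ∈ V) → ∑ x, |f x - g x| ≤ ∑ x, |f x - g' x| := by
  obtain ⟨v, hv⟩ := hV
  have : Nonempty {g : (Fin n → Bool) → V // Monotone g} := ⟨fun _ => ⟨v, hv⟩, monotone_const⟩
  obtain ⟨g, hg⟩ := Finite.exists_min
    fun g : {g : (Fin n → Bool) → V // Monotone g} => ∑ x, |f x - g.1 x|
  exact ⟨fun x => g.1 x, fun x y hxy => g.2 hxy, fun x => (g.1 x).2, fun g' hg' hgV' =>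
    hg ⟨fun x => ⟨g' x, hgV' x⟩, fun x y hxy => hg' hxy⟩⟩

end Optimal

/-- The robust directed Talagrand inequality for real-valued functions. -/
theorem exists_monotone_card_ne_le {n : ℕ} (f : (Fin n → Bool) → ℝ)
    (R B : (Fin n → Bool) → Finset (Fin n))
    (hRB : ∀ j x, x j = false → f (flipAt j x) < f x → j ∈ R x ∨ j ∈ B (flipAt j x)) :
    ∃ g, Monotone g ∧ (#{x | f x ≠ g x} : ℝ) ≤
      8 * Real.pi * ∑ x, (Real.sqrt (#(R x)) + Real.sqrt (#(B x))) := by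
  classical
  set V := univ.image f with hV
  have hfV : ∀ x, f x ∈ V := fun x => mem_image_of_mem f (mem_univ x)
  obtain ⟨g, hg, hgV, hopt⟩ := exists_monotone_sum_abs_le (V := V) f ⟨_, hfV fun _ => false⟩
  refine ⟨g, hg, ?_⟩
  have hlevel : ∀ v, (#{x ∈ ({x | f x ≠ g x} : Finset _) | g x = v} : ℝ) ≤ 8 * Real.pi *
      ∑ x, if g x = v then Real.sqrt (#(R x)) + Real.sqrt (#(B x)) else 0 := by
    intro v
    have hsplit : #{x ∈ ({x | f x ≠ g x} : Finset _) | g x = v} ≤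
        #{x | g x = v ∧ v < f x} + #{x | g x = v ∧ f x < v} := by
      refine (Finset.card_le_card fun x hx => ?_).trans (Finset.card_union_le _ _)
      simp only [mem_filter, mem_union, mem_univ, true_and] at *
      rcases lt_or_gt_of_ne hx.1 with h | h
      · exact Or.inr ⟨hx.2, hx.2 ▸ h⟩
      · exact Or.inl ⟨hx.2, hx.2 ▸ h⟩
    have hsplit : (#{x ∈ ({x | f x ≠ g x} : Finset _) | g x = v} : ℝ) ≤
        #{x | g x = v ∧ v < f x} + #{x | g x = v ∧ f x < v} := by exact_mod_cast hsplit
    have hF₁ : ∀ x, decide (v < g x ∨ g x = v ∧ v < f x) = true ↔ v < g x ∨ g x = v ∧ v < f x :=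
      fun x => decide_eq_true_iff
    have hF₂ : ∀ x, decide (v < g x ∨ g x = v ∧ v ≤ f x) = true ↔ v < g x ∨ g x = v ∧ v ≤ f x :=
      fun x => decide_eq_true_iff
    obtain ⟨h₁, hm₁, hd₁⟩ := exists_monotone_hdist_level_le hg hRB v (p := (v < ·))
      (fun a b hab ha => lt_of_lt_of_le ha hab) hF₁
    obtain ⟨h₂, hm₂, hd₂⟩ := exists_monotone_hdist_level_le hg hRB v (p := (v ≤ ·))
      (fun a b hab ha => le_trans ha hab) hF₂
    have := card_lt_le_hdist hg hgV hfV hopt hF₁ hm₁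
    have := card_gt_le_hdist hg hgV hfV hopt hF₂ hm₂
    linarith
  rw [Finset.card_eq_sum_card_fiberwise fun x _ => hgV x]
  push_cast
  refine (Finset.sum_le_sum fun v _ => hlevel v).trans (le_of_eq ?_)
  rw [← Finset.mul_sum, Finset.sum_comm]
  congr 1
  refine Finset.sum_congr rfl fun x _ => ?_
  rw [Finset.sum_ite_eq, if_pos (hgV x)]

lemma isEdge_flipAt {d : ℕ} {x : Fin d → Bool} {i : Fin d} (h : x i = false) :
    IsEdge x (flipAt i x) :=
  ⟨i, h, by simp [flipAt_apply_self, h], fun _ hj => (flipAt_apply_of_ne hj x).symm⟩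

lemma flipAt_injective_left {d : ℕ} (x : Fin d → Bool) :
    Function.Injective fun i => flipAt i x := by
  intro i j hij
  by_contra hne
  have := congrFun hij i
  simp only [flipAt_apply_self, flipAt_apply_of_ne hne] at this
  cases h : x i <;> simp [h] at this

lemma card_le_redOut (d : ℕ) (f : (Fin d → Bool) → ℝ)
    (col : (Fin d → Bool) × (Fin d → Bool) → Bool) (x : Fin d → Bool) :
    #{j | x j = false ∧ f (flipAt j x) < f x ∧ col (x, flipAt j x) = true} ≤ redOut d f col x := by
  rw [redOut, ← Fintype.card_coe, ← Nat.card_eq_fintype_card]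
  refine Nat.card_le_card_of_injective
    (fun j => ⟨flipAt j x, isEdge_flipAt (mem_filter.1 j.2).2.1, (mem_filter.1 j.2).2.2⟩)
    fun i j hij => ?_
  exact Subtype.ext (flipAt_injective_left x (congrArg Subtype.val hij))

lemma card_le_blueIn (d : ℕ) (f : (Fin d → Bool) → ℝ)
    (col : (Fin d → Bool) × (Fin d → Bool) → Bool) (y : Fin d → Bool) :
    #{j | y j = true ∧ f y < f (flipAt j y) ∧ col (flipAt j y, y) = false} ≤ blueIn d f col y := by
  rw [blueIn, ← Fintype.card_coe, ← Nat.card_eq_fintype_card]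
  refine Nat.card_le_card_of_injective
    (fun j => ⟨flipAt j y, ?_, (mem_filter.1 j.2).2.2⟩) fun i j hij => ?_
  · have h : (flipAt j y) j = false := by
      rw [flipAt_apply_self, (mem_filter.1 j.2).2.1]
      rfl
    simpa only [flipAt_flipAt] using isEdge_flipAt h
  · exact Subtype.ext (flipAt_injective_left y (congrArg Subtype.val hij))

/-- Robust isoperimetric inequality for real-valued functions. -/
theorem robust_talagrand_real :
    ∃ C : ℝ, 0 < C ∧ ∀ d : ℕ, 1 ≤ d → ∀ f : (Fin d → Bool) → ℝ,
      ∀ col : (Fin d → Bool) × (Fin d → Bool) → Bool,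
        (∑ x : Fin d → Bool, Real.sqrt (redOut d f col x)) / 2 ^ d +
          (∑ y : Fin d → Bool, Real.sqrt (blueIn d f col y)) / 2 ^ d
          ≥ C * distMono d f := by
  refine ⟨1 / (8 * Real.pi), by positivity, fun d _ f col => ?_⟩
  obtain ⟨g, hg, hd⟩ := exists_monotone_card_ne_le f
    (fun x => {j | x j = false ∧ f (flipAt j x) < f x ∧ col (x, flipAt j x) = true})
    (fun y => {j | y j = true ∧ f y < f (flipAt j y) ∧ col (flipAt j y, y) = false})
    fun j x hx hlt => by
      cases hc : col (x, flipAt j x) <;> simp [hx, hlt, hc, flipAt_flipAt, flipAt_apply_self]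
  have hdist : distMono d f ≤ #{x | f x ≠ g x} / 2 ^ d := by
    unfold distMono
    gcongr
    refine Nat.sInf_le ⟨g, fun x y hxy => hg hxy, ?_⟩
    rw [Nat.card_eq_fintype_card, Fintype.card_subtype]
  have hsum : ∑ x : Fin d → Bool, (Real.sqrt
        (#{j | x j = false ∧ f (flipAt j x) < f x ∧ col (x, flipAt j x) = true})
      + Real.sqrt (#{j | x j = true ∧ f x < f (flipAt j x) ∧ col (flipAt j x, x) = false})) ≤
      ∑ x : Fin d → Bool, Real.sqrt (redOut d f col x) +
        ∑ y : Fin d → Bool, Real.sqrt (blueIn d f col y) := by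
    rw [← Finset.sum_add_distrib]
    refine Finset.sum_le_sum fun x _ => add_le_add ?_ ?_
    · exact Real.sqrt_le_sqrt (by exact_mod_cast card_le_redOut d f col x)
    · exact Real.sqrt_le_sqrt (by exact_mod_cast card_le_blueIn d f col x)
  rw [ge_iff_le, ← add_div, one_div, inv_mul_le_iff₀ (by positivity)]
  refine hdist.trans ?_
  rw [← mul_div_assoc]
  gcongr
  exact hd.trans (by gcongr)
end

section
/- Let G be a finite DAG and let f : V(G) → ℝ be a non-monotone function. Then for some k ≥ 1 there exist Boolean functions f_1, …, f_k : V(G) → {0,1} and pairwise disjoint vertex subsets V_1, …, V_k ⊆ V(G) such that: (1) 2 · Σ_{i=1}^k ε(f_i) ≥ ε(f); and (2) for every i ∈ [k], every edge of G violated by f_i is also violated by f and has both of its endpoints in V_i (i.e., S_{f_i}^- ⊆ S_f^- ∩ E(H_i), where H_i is the subgraph of G induced on V_i). -/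
/-- Distance to monotonicity of `f : V → ℝ` over a DAG with edge relation `E`
(monotone means respecting the reachability preorder). -/
noncomputable def distMonoDAG {V : Type*} [Fintype V] (E : V → V → Prop) (f : V → ℝ) : ℝ :=
  ((sInf {n : ℕ | ∃ g : V → ℝ,
      (∀ x y : V, Relation.ReflTransGen E x y → g x ≤ g y) ∧
      n = Nat.card {x : V // f x ≠ g x}} : ℕ) : ℝ) / Fintype.card V

/-- A directed walk can be shortened to a duplicate-free one. -/
theorem exists_nodup_isChain_of_reflTransGen {α : Type*} {R : α → α → Prop} {a b : α}
    (h : Relation.ReflTransGen R a b) :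
    ∃ l : List α, (a :: l).IsChain R ∧ (a :: l).Nodup ∧
      (a :: l).getLast (List.cons_ne_nil a l) = b := by
  classical
  induction h using Relation.ReflTransGen.head_induction_on with
  | refl => exact ⟨[], by simp⟩
  | @head a c hac _ ih =>
    obtain ⟨l, hc, hn, hl⟩ := ih
    by_cases ha : a ∈ c :: l
    · obtain ⟨s, t, hst⟩ := List.append_of_mem ha
      refine ⟨t, ?_, ?_, ?_⟩
      · rw [hst] at hc
        exact (List.isChain_append.1 hc).2.1
      · rw [hst] at hn
        exact (List.nodup_append.1 hn).2.1
      · rw [← hl]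
        simp [hst]
    · exact ⟨c :: l, List.isChain_cons_cons.2 ⟨hac, hc⟩, List.nodup_cons.2 ⟨ha, hn⟩,
        by simpa using hl⟩

/-- A directed walk from `a` to `b` in a reflexive relation, closed up by sending `b` to `a`,
yields a permutation following the relation at every point other than `b`. -/
theorem exists_perm_of_reflTransGen {α : Type*} {R : α → α → Prop} (hR : ∀ x, R x x) {a b : α}
    (h : Relation.ReflTransGen R a b) :
    ∃ σ : Equiv.Perm α, σ b = a ∧ ∀ x, x ≠ b → R x (σ x) := by
  classical
  obtain ⟨l, hc, hn, hl⟩ := exists_nodup_isChain_of_reflTransGen h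
  refine ⟨(a :: l).formPerm, ?_, fun x hx => ?_⟩
  · rw [← hl]
    exact List.formPerm_apply_getLast a l
  · by_cases hxl : x ∈ a :: l
    · obtain ⟨i, hi, rfl⟩ := List.getElem_of_mem hxl
      have hi' : i + 1 < (a :: l).length := by
        by_contra hcon
        apply hx
        rw [← hl, List.getLast_eq_getElem]
        congr 1
        omega
      rw [List.formPerm_apply_lt_getElem _ hn _ hi']
      exact List.isChain_iff_getElem.1 hc i hi'
    · rw [List.formPerm_apply_of_notMem hxl]
      exact hR x

/-- A set of pairs violating monotonicity of `f` with distinct sources and distinct targets. -/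
structure IsViolationMatching {V : Type*} (r : V → V → Prop) (f : V → ℝ)
    (M : Finset (V × V)) : Prop where
  rel : ∀ p ∈ M, r p.1 p.2
  lt : ∀ p ∈ M, f p.2 < f p.1
  fst_inj : Set.InjOn Prod.fst (M : Set (V × V))
  snd_inj : Set.InjOn Prod.snd (M : Set (V × V))

/-- There is a violation matching of maximum weight with the fewest pairs. -/
theorem exists_optimal_violationMatching {V : Type*} [Finite V] (r : V → V → Prop) (f : V → ℝ) :
    ∃ M, IsViolationMatching r f M ∧
      (∀ N, IsViolationMatching r f N → ∑ p ∈ N, (f p.1 - f p.2) ≤ ∑ p ∈ M, (f p.1 - f p.2)) ∧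
      ∀ N, IsViolationMatching r f N →
        ∑ p ∈ M, (f p.1 - f p.2) ≤ ∑ p ∈ N, (f p.1 - f p.2) → M.card ≤ N.card := by
  have h0 : IsViolationMatching r f ∅ := ⟨by simp, by simp, by simp, by simp⟩
  obtain ⟨M₀, hM₀, hmax⟩ := Set.exists_max_image {M | IsViolationMatching r f M}
    (fun M => ∑ p ∈ M, (f p.1 - f p.2)) (Set.toFinite _) ⟨∅, h0⟩
  obtain ⟨M, ⟨hM, hMw⟩, hmin⟩ := Set.exists_min_image
    {M | IsViolationMatching r f M ∧ ∑ p ∈ M₀, (f p.1 - f p.2) ≤ ∑ p ∈ M, (f p.1 - f p.2)}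
    Finset.card (Set.toFinite _) ⟨M₀, hM₀, le_rfl⟩
  exact ⟨M, hM, fun N hN => (hmax N hN).trans hMw, fun N hN h => hmin N ⟨hN, hMw.trans h⟩⟩

/-- Two pairs of a matching are joined when the source of the first lies below the target of
the second. -/
def CrossRel {V : Type*} (r : V → V → Prop) (M : Finset (V × V)) (p q : M) : Prop :=
  r p.1.1 q.1.2

/-- In an optimal matching, a source lying below the target of a pair in the same strongly
connected component has a strictly larger value. -/
theorem IsViolationMatching.lt_of_crossRel {V : Type*} {r : V → V → Prop} {f : V → ℝ}
    {M : Finset (V × V)} (hM : IsViolationMatching r f M)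
    (hmin : ∀ N, IsViolationMatching r f N →
        ∑ p ∈ M, (f p.1 - f p.2) ≤ ∑ p ∈ N, (f p.1 - f p.2) → M.card ≤ N.card)
    {p q : M} (hqp : Relation.ReflTransGen (CrossRel r M) q p) :
    f q.1.2 < f p.1.1 := by
  classical
  obtain ⟨σ, hσp, hσ⟩ := exists_perm_of_reflTransGen (R := CrossRel r M)
    (fun x => hM.rel x.1 x.2) hqp
  by_contra! hle
  let A : Finset M := (Finset.univ.erase p).filter fun x => f (σ x).1.2 < f x.1.1
  let φ : M → V × V := fun x => (x.1.1, (σ x).1.2)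
  have hφ : Function.Injective φ := fun x y hxy =>
    Subtype.ext (hM.fst_inj x.2 y.2 (Prod.ext_iff.1 hxy).1)
  have hN : IsViolationMatching r f (A.image φ) := by
    refine ⟨?_, ?_, ?_, ?_⟩
    · intro z hz
      obtain ⟨x, hx, rfl⟩ := Finset.mem_image.1 hz
      exact hσ x (Finset.ne_of_mem_erase (Finset.mem_filter.1 hx).1)
    · intro z hz
      obtain ⟨x, hx, rfl⟩ := Finset.mem_image.1 hz
      exact (Finset.mem_filter.1 hx).2
    · intro z hz w hw hzw
      obtain ⟨x, -, rfl⟩ := Finset.mem_image.1 (Finset.mem_coe.1 hz)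
      obtain ⟨y, -, rfl⟩ := Finset.mem_image.1 (Finset.mem_coe.1 hw)
      exact congrArg φ (Subtype.ext (hM.fst_inj x.2 y.2 hzw))
    · intro z hz w hw hzw
      obtain ⟨x, -, rfl⟩ := Finset.mem_image.1 (Finset.mem_coe.1 hz)
      obtain ⟨y, -, rfl⟩ := Finset.mem_image.1 (Finset.mem_coe.1 hw)
      exact congrArg φ (σ.injective (Subtype.ext (hM.snd_inj (σ x).2 (σ y).2 hzw)))
  have hcard : (A.image φ).card < M.card := by
    rw [Finset.card_image_of_injective _ hφ]
    calc A.card ≤ (Finset.univ.erase p).card := Finset.card_filter_le _ _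
      _ < (Finset.univ : Finset M).card := Finset.card_erase_lt_of_mem (Finset.mem_univ p)
      _ = M.card := by simp
  refine (hmin _ hN ?_).not_gt hcard
  have hperm : ∑ x : M, f (σ x).1.2 = ∑ x : M, f x.1.2 :=
    Equiv.sum_comp σ fun x : M => f x.1.2
  have herase := Finset.add_sum_erase Finset.univ (fun x : M => f x.1.1 - f (σ x).1.2)
    (Finset.mem_univ p)
  have hfilter := Finset.sum_filter_add_sum_filter_not (Finset.univ.erase p)
    (fun x : M => f (σ x).1.2 < f x.1.1) (fun x : M => f x.1.1 - f (σ x).1.2)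
  have hneg : ∑ x ∈ (Finset.univ.erase p).filter (fun x : M => ¬ f (σ x).1.2 < f x.1.1),
      (f x.1.1 - f (σ x).1.2) ≤ 0 := Finset.sum_nonpos fun x hx => by
    linarith [not_lt.1 (Finset.mem_filter.1 hx).2]
  rw [Finset.sum_image fun x _ y _ h => hφ h,
    ← Finset.sum_coe_sort M fun p => f p.1 - f p.2, Finset.sum_sub_distrib, ← hperm,
    ← Finset.sum_sub_distrib]
  simp only [hσp] at herase
  change _ ≤ ∑ x ∈ A, (f x.1.1 - f (σ x).1.2)
  change ∑ x ∈ A, (f x.1.1 - f (σ x).1.2) + _ = _ at hfilter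
  linarith

/-- A maximum-weight violation matching covers every violated pair. -/
theorem IsViolationMatching.cover {V : Type*} {r : V → V → Prop} {f : V → ℝ}
    {M : Finset (V × V)} (hM : IsViolationMatching r f M)
    (hmax : ∀ N, IsViolationMatching r f N →
      ∑ p ∈ N, (f p.1 - f p.2) ≤ ∑ p ∈ M, (f p.1 - f p.2))
    {x y : V} (hxy : r x y) (hlt : f y < f x) :
    (∃ p ∈ M, p.1 = x) ∨ ∃ p ∈ M, p.2 = y := by
  classical
  by_contra! hcon
  obtain ⟨hx, hy⟩ := hcon
  have hnot : (x, y) ∉ M := fun h => hx _ h rfl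
  have hN : IsViolationMatching r f (insert (x, y) M) := by
    refine ⟨?_, ?_, ?_, ?_⟩
    · simpa [hxy] using fun a b h => hM.rel (a, b) h
    · simpa [hlt] using fun a b h => hM.lt (a, b) h
    · rw [Finset.coe_insert, Set.injOn_insert (by simpa using hnot)]
      exact ⟨hM.fst_inj, fun ⟨p, hp, hpx⟩ => hx p hp hpx⟩
    · rw [Finset.coe_insert, Set.injOn_insert (by simpa using hnot)]
      exact ⟨hM.snd_inj, fun ⟨p, hp, hpy⟩ => hy p hp hpy⟩
  have := hmax _ hN
  rw [Finset.sum_insert hnot] at this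
  simp only at this
  linarith

/-- A function can be made monotone by changing it on any set meeting all violated pairs. -/
theorem exists_monotone_eq_off_cover {V : Type*} [Finite V] {r : V → V → Prop}
    (hrefl : ∀ x, r x x) (htrans : ∀ x y z, r x y → r y z → r x z) (f : V → ℝ) (C : Set V)
    (hC : ∀ x y, r x y → f y < f x → x ∈ C ∨ y ∈ C) :
    ∃ g : V → ℝ, (∀ x y, r x y → g x ≤ g y) ∧ ∀ x, x ∉ C → f x = g x := by
  classical
  cases isEmpty_or_nonempty V with
  | inl h => exact ⟨f, fun x => (h.false x).elim, fun _ _ => rfl⟩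
  | inr h =>
    obtain ⟨m, hm⟩ := Finite.exists_min f
    let F : V → V → ℝ := fun x z => if r z x ∧ z ∉ C then f z else f m
    have hF : ∀ x, BddAbove (Set.range (F x)) := fun x => (Set.finite_range _).bddAbove
    refine ⟨fun x => ⨆ z, F x z, fun x y hxy => ciSup_le fun z => ?_, fun x hx => ?_⟩
    · refine le_trans ?_ (le_ciSup (hF y) z)
      simp only [F]
      split_ifs with h1 h2 h2
      · exact le_rfl
      · exact absurd ⟨htrans z x y h1.1 hxy, h1.2⟩ h2
      · exact hm z
      · exact le_rfl
    · apply le_antisymm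
      · refine le_trans ?_ (le_ciSup (hF x) x)
        simp [F, hrefl, hx]
      · refine ciSup_le fun z => ?_
        simp only [F]
        split_ifs with h1
        · by_contra! hlt
          exact (hC z x h1.1 hlt).elim h1.2 hx
        · exact hm x

theorem distMonoDAG_le_of_cover {V : Type*} [Fintype V] (E : V → V → Prop) (f : V → ℝ)
    (C : Finset V)
    (hC : ∀ x y, Relation.ReflTransGen E x y → f y < f x → x ∈ C ∨ y ∈ C) :
    distMonoDAG E f ≤ (C.card : ℝ) / Fintype.card V := by
  obtain ⟨g, hg, hgf⟩ := exists_monotone_eq_off_cover (r := Relation.ReflTransGen E)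
    (fun _ => .refl) (fun _ _ _ h₁ h₂ => h₁.trans h₂) f (C : Set V) hC
  unfold distMonoDAG
  gcongr
  refine le_trans (Nat.sInf_le (m := Nat.card {x : V // f x ≠ g x}) ⟨g, hg, rfl⟩) ?_
  rw [← Nat.card_eq_finsetCard C]
  exact Nat.card_le_card_of_injective
    (fun x : {x : V // f x ≠ g x} => (⟨x.1, by_contra fun h => x.2 (hgf x.1 h)⟩ : C))
    fun x y h => Subtype.ext (congrArg (fun z : C => z.1) h)

theorem le_distMonoDAG {V : Type*} [Fintype V] (E : V → V → Prop) (f : V → ℝ) (c : ℕ)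
    (h : ∀ g : V → ℝ, (∀ x y, Relation.ReflTransGen E x y → g x ≤ g y) →
      c ≤ Nat.card {x : V // f x ≠ g x}) :
    (c : ℝ) / Fintype.card V ≤ distMonoDAG E f := by
  unfold distMonoDAG
  gcongr
  refine le_csInf ⟨_, fun _ => 0, fun _ _ _ => le_rfl, rfl⟩ ?_
  rintro n ⟨g, hg, rfl⟩
  exact h g hg

/-- Disjoint violated pairs of a Boolean function bound its distance to monotonicity below. -/
theorem card_div_le_distMonoDAG {V ι : Type*} [Fintype V] (E : V → V → Prop) (f : V → ℝ)
    (s t : ι → V) (hs : Function.Injective s) (ht : Function.Injective t)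
    (hst : ∀ i, Relation.ReflTransGen E (s i) (t i))
    (hs1 : ∀ i, f (s i) = 1) (ht0 : ∀ i, f (t i) = 0) :
    (Nat.card ι : ℝ) / Fintype.card V ≤ distMonoDAG E f := by
  classical
  refine le_distMonoDAG E f _ fun g hg => ?_
  have key : ∀ i, f (s i) = g (s i) → f (t i) ≠ g (t i) := fun i h₁ h₂ => by
    have := hg _ _ (hst i)
    rw [← h₁, ← h₂, hs1, ht0] at this
    linarith
  refine Nat.card_le_card_of_injective (fun i => if h : f (s i) = g (s i)
    then (⟨t i, key i h⟩ : {x : V // f x ≠ g x}) else ⟨s i, h⟩) fun i j hij => ?_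
  have hne : ∀ i j, s i ≠ t j := fun i j h => by
    have := hs1 i
    rw [h, ht0] at this
    exact zero_ne_one this
  simp only at hij
  split_ifs at hij
  · exact ht (congrArg Subtype.val hij)
  · exact (hne _ _ (congrArg Subtype.val hij).symm).elim
  · exact (hne _ _ (congrArg Subtype.val hij)).elim
  · exact hs (congrArg Subtype.val hij)

/-- The vertices lying between a source and a target of a family of pairs. -/
def sweep {V : Type*} (r : V → V → Prop) (A : Set (V × V)) : Set V :=
  {z | (∃ p ∈ A, r p.1 z) ∧ ∃ p ∈ A, r z p.2}

/-- The Boolean function equal to one exactly above the sources of `A`, at the vertices whose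
value exceeds that of every target of `A` above them. -/
noncomputable def sweepIndicator {V : Type*} (r : V → V → Prop) (f : V → ℝ) (A : Set (V × V)) :
    V → ℝ :=
  Set.indicator {z | (∃ p ∈ A, r p.1 z) ∧ ∀ p ∈ A, r z p.2 → f p.2 < f z} 1

theorem sweepIndicator_violated {V : Type*} {r : V → V → Prop}
    (htrans : ∀ x y z, r x y → r y z → r x z) (f : V → ℝ) (A : Set (V × V)) {x y : V}
    (hxy : r x y) (h : sweepIndicator r f A y < sweepIndicator r f A x) :
    f y < f x ∧ x ∈ sweep r A ∧ y ∈ sweep r A := by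
  classical
  unfold sweepIndicator at h
  simp only [Set.indicator_apply, Pi.one_apply] at h
  split_ifs at h with hy hx hx
  · exact (lt_irrefl _ h).elim
  · linarith
  · obtain ⟨⟨p, hp, hpx⟩, hxA⟩ := hx
    have hpy := htrans _ _ _ hpx hxy
    have : ∃ q ∈ A, r y q.2 ∧ f y ≤ f q.2 := by
      by_contra! hcon
      exact hy ⟨⟨p, hp, hpy⟩, hcon⟩
    obtain ⟨q, hq, hyq, hle⟩ := this
    have hxq := htrans _ _ _ hxy hyq
    exact ⟨hle.trans_lt (hxA q hq hxq), ⟨⟨p, hp, hpx⟩, q, hq, hxq⟩, ⟨p, hp, hpy⟩, q, hq, hyq⟩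
  · exact (lt_irrefl _ h).elim

/-- The strongly connected components of the crossing relation of a matching. -/
def crossSetoid {V : Type*} (r : V → V → Prop) (M : Finset (V × V)) : Setoid M where
  r p q := Relation.ReflTransGen (CrossRel r M) p q ∧ Relation.ReflTransGen (CrossRel r M) q p
  iseqv := ⟨fun _ => ⟨.refl, .refl⟩, fun h => ⟨h.2, h.1⟩,
    fun h₁ h₂ => ⟨h₁.1.trans h₂.1, h₂.2.trans h₁.2⟩⟩

/-- The pairs of a matching in a given strongly connected component. -/
def crossComponent {V : Type*} (r : V → V → Prop) (M : Finset (V × V))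
    (c : Quotient (crossSetoid r M)) : Set (V × V) :=
  {p | ∃ h : p ∈ M, Quotient.mk (crossSetoid r M) ⟨p, h⟩ = c}

theorem disjoint_sweep_crossComponent {V : Type*} {r : V → V → Prop}
    (htrans : ∀ x y z, r x y → r y z → r x z) (M : Finset (V × V))
    {c d : Quotient (crossSetoid r M)} (hcd : c ≠ d) :
    Disjoint (sweep r (crossComponent r M c)) (sweep r (crossComponent r M d)) := by
  rw [Set.disjoint_left]
  rintro z ⟨⟨p, ⟨hp, rfl⟩, hpz⟩, ⟨p', ⟨hp', hpp'⟩, hzp'⟩⟩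
    ⟨⟨q, ⟨hq, rfl⟩, hqz⟩, ⟨q', ⟨hq', hqq'⟩, hzq'⟩⟩
  have hpp' := Quotient.exact hpp'
  have hqq' := Quotient.exact hqq'
  refine hcd (Quotient.sound ⟨?_, ?_⟩)
  · exact .head (show CrossRel r M ⟨p, hp⟩ ⟨q', hq'⟩ from htrans _ _ _ hpz hzq') hqq'.1
  · exact .head (show CrossRel r M ⟨q, hq⟩ ⟨p', hp'⟩ from htrans _ _ _ hqz hzp') hpp'.1

/-- Boolean decomposition: every non-monotone real-valued function on a finite DAG
decomposes into Boolean functions `fs i` violating edges in disjoint induced subgraphs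
`Vs i`, collectively preserving the distance to monotonicity up to a factor of 2. -/
theorem boolean_decomposition {V : Type*} [Fintype V] (E : V → V → Prop)
    (hacyc : ∀ x y : V, Relation.ReflTransGen E x y → Relation.ReflTransGen E y x → x = y)
    (f : V → ℝ)
    (hnm : ¬ ∀ x y : V, Relation.ReflTransGen E x y → f x ≤ f y) :
    ∃ (k : ℕ), 1 ≤ k ∧ ∃ (fs : Fin k → V → ℝ) (Vs : Fin k → Set V),
      (∀ i : Fin k, ∀ v : V, fs i v = 0 ∨ fs i v = 1) ∧
      (∀ i j : Fin k, i ≠ j → Disjoint (Vs i) (Vs j)) ∧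
      2 * ∑ i : Fin k, distMonoDAG E (fs i) ≥ distMonoDAG E f ∧
      (∀ i : Fin k, ∀ x y : V, E x y → fs i x > fs i y →
        f x > f y ∧ x ∈ Vs i ∧ y ∈ Vs i) := by
  classical
  set r := Relation.ReflTransGen E
  have hrefl : ∀ x, r x x := fun _ => .refl
  have htrans : ∀ x y z, r x y → r y z → r x z := fun _ _ _ h₁ h₂ => h₁.trans h₂
  obtain ⟨M, hM, hmax, hmin⟩ := exists_optimal_violationMatching r f
  let Q := Quotient (crossSetoid r M)
  have hdist : ∀ c : Q, (Fintype.card {p : M // Quotient.mk (crossSetoid r M) p = c} : ℝ) /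
      Fintype.card V ≤ distMonoDAG E (sweepIndicator r f (crossComponent r M c)) := fun c => by
    rw [← Nat.card_eq_fintype_card]
    refine card_div_le_distMonoDAG E _ (fun p => p.1.1.1) (fun p => p.1.1.2) ?_ ?_ ?_ ?_ ?_
    · exact fun p q h => Subtype.ext (Subtype.ext (hM.fst_inj p.1.2 q.1.2 h))
    · exact fun p q h => Subtype.ext (Subtype.ext (hM.snd_inj p.1.2 q.1.2 h))
    · exact fun p => hM.rel _ p.1.2
    · rintro ⟨p, hp⟩
      refine Set.indicator_of_mem (Set.mem_ofPred.2 ⟨⟨p.1, ⟨p.2, hp⟩, hrefl _⟩, ?_⟩) _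
      rintro q ⟨hq, hqc⟩ -
      exact hM.lt_of_crossRel hmin (p := p) (q := ⟨q, hq⟩) (Quotient.exact (hqc.trans hp.symm)).1
    · rintro ⟨p, hp⟩
      exact Set.indicator_of_notMem (fun h => lt_irrefl _ (h.2 p.1 ⟨p.2, hp⟩ (hrefl _))) _
  have hcover : ∀ x y, r x y → f y < f x →
      x ∈ M.image Prod.fst ∪ M.image Prod.snd ∨ y ∈ M.image Prod.fst ∪ M.image Prod.snd := by
    intro x y hxy hlt
    rcases hM.cover hmax hxy hlt with ⟨p, hp, rfl⟩ | ⟨p, hp, rfl⟩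
    · exact .inl (Finset.mem_union_left _ (Finset.mem_image_of_mem _ hp))
    · exact .inr (Finset.mem_union_right _ (Finset.mem_image_of_mem _ hp))
  have hle : distMonoDAG E f ≤
      2 * ∑ c : Q, distMonoDAG E (sweepIndicator r f (crossComponent r M c)) := by
    have hsum : ∑ c : Q, Fintype.card {p : M // Quotient.mk (crossSetoid r M) p = c} = M.card := by
      rw [← Fintype.card_sigma, Fintype.card_congr (Equiv.sigmaFiberEquiv _), Fintype.card_coe]
    have hcard : (M.image Prod.fst ∪ M.image Prod.snd).card ≤ 2 * M.card :=
      (Finset.card_union_le _ _).trans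
        (by linarith [Finset.card_image_le (s := M) (f := Prod.fst),
          Finset.card_image_le (s := M) (f := Prod.snd)])
    calc distMonoDAG E f
        ≤ ((M.image Prod.fst ∪ M.image Prod.snd).card : ℝ) / Fintype.card V :=
          distMonoDAG_le_of_cover E f _ hcover
      _ ≤ ((2 * M.card : ℕ) : ℝ) / Fintype.card V := by gcongr
      _ = 2 * ∑ c : Q, (Fintype.card {p : M // Quotient.mk (crossSetoid r M) p = c} : ℝ) /
            Fintype.card V := by
          rw [← Finset.sum_div, ← Nat.cast_sum, hsum]
          push_cast
          ring
      _ ≤ _ := by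
          gcongr with c
          exact hdist c
  have hQ : Nonempty Q := by
    push Not at hnm
    obtain ⟨x, y, hxy, hlt⟩ := hnm
    rcases hM.cover hmax hxy hlt with ⟨p, hp, -⟩ | ⟨p, hp, -⟩ <;> exact ⟨Quotient.mk _ ⟨p, hp⟩⟩
  let e : Fin (Fintype.card Q) ≃ Q := (Fintype.equivFin Q).symm
  refine ⟨Fintype.card Q, Fintype.card_pos, fun i => sweepIndicator r f (crossComponent r M (e i)),
    fun i => sweep r (crossComponent r M (e i)), fun i v => ?_,
    fun i j hij => disjoint_sweep_crossComponent htrans M (e.injective.ne hij), ?_,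
    fun i x y hxy h => sweepIndicator_violated htrans f _ (.single hxy) h⟩
  · exact Set.indicator_eq_zero_or_self _ _ v
  · rw [Equiv.sum_comp e fun c => distMonoDAG E (sweepIndicator r f (crossComponent r M c))]
    exact hle
end
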